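/- arXiv:math/0005150 — 3 statements merged into one kernel-verified Lean document; each statement's English description precedes it below -/
import Mathlib

section
/- (Commutative case of Theorem 1.1.) Let (Ω, μ) be an atomless probability space, 1 ≤ p < 2, and let (x_{ij})_{i,j∈ℕ} be an infinite matrix of elements of L^p(μ). Assume that for some C ≥ 1 every row (x_{ij})_{j∈ℕ} and every column (x_{ij})_{i∈ℕ} is C-equivalent to the usual ℓ² basis, and that every generalized diagonal of (x_{ij}) is an unconditional sequence. Then there exist i_1 < i_2 < ⋯ and j_1 < j_2 < ⋯ such that, setting y_k = x_{i_k, j_k}, one has lim_{n→∞} n^{-1/p} ‖∑_{i=1}^n y'_i‖_{L^p(μ)} = 0 for every subsequence (y'_k) of (y_k). -/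
open MeasureTheory Filter
open scoped ENNReal NNReal BigOperators

noncomputable section

variable {E : Type*} [NormedAddCommGroup E] [NormedSpace ℝ E]

/-- `x` is `K`-equivalent to the usual `ℓ^q` basis. -/
def IsLqBasisEquiv (q K : ℝ) (x : ℕ → E) : Prop :=
  ∀ (s : Finset ℕ) (a : ℕ → ℝ),
    (1 / K) * (∑ k ∈ s, |a k| ^ q) ^ (1 / q) ≤ ‖∑ k ∈ s, a k • x k‖ ∧
      ‖∑ k ∈ s, a k • x k‖ ≤ K * (∑ k ∈ s, |a k| ^ q) ^ (1 / q)

/-- `x` is `K`-equivalent to the usual `ℓ^q_n` basis. -/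
def IsLqBasisEquivFin (q K : ℝ) {n : ℕ} (x : Fin n → E) : Prop :=
  ∀ a : Fin n → ℝ,
    (1 / K) * (∑ k, |a k| ^ q) ^ (1 / q) ≤ ‖∑ k, a k • x k‖ ∧
      ‖∑ k, a k • x k‖ ≤ K * (∑ k, |a k| ^ q) ^ (1 / q)

/-- `x` is `u`-unconditional. -/
def IsUnconditionalWith (u : ℝ) (x : ℕ → E) : Prop :=
  ∀ (s : Finset ℕ) (c ε : ℕ → ℝ), (∀ k ∈ s, |ε k| = 1) →
    ‖∑ k ∈ s, (ε k * c k) • x k‖ ≤ u * ‖∑ k ∈ s, c k • x k‖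

/-- `x` is unconditional. -/
def IsUnconditional (x : ℕ → E) : Prop :=
  ∃ u : ℝ, 1 ≤ u ∧ IsUnconditionalWith u x

/-- Finite version of `u`-unconditionality. -/
def IsUnconditionalWithFin (u : ℝ) {n : ℕ} (x : Fin n → E) : Prop :=
  ∀ (c ε : Fin n → ℝ), (∀ k, |ε k| = 1) →
    ‖∑ k, (ε k * c k) • x k‖ ≤ u * ‖∑ k, c k • x k‖

/-- The measure `μ` is atomless: every measurable set of positive measure contains a
measurable subset of strictly smaller positive measure. -/
def Atomless {Ω : Type*} [MeasurableSpace Ω] (μ : Measure Ω) : Prop :=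
  ∀ A : Set Ω, MeasurableSet A → 0 < μ A →
    ∃ B, B ⊆ A ∧ MeasurableSet B ∧ 0 < μ B ∧ μ B < μ A

/-- The family `(|f n|^p)` is uniformly integrable. -/
def UnifIntPow {Ω : Type*} [MeasurableSpace Ω] (μ : Measure Ω) (p : ℝ) (f : ℕ → Ω → ℝ) : Prop :=
  ∀ ε : ℝ, 0 < ε → ∃ δ : ℝ, 0 < δ ∧ ∀ n, ∀ A : Set Ω, MeasurableSet A →
    μ A ≤ ENNReal.ofReal δ → ∫ x in A, |f n x| ^ p ∂μ ≤ ε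

/-- `(f n)` is weakly null in `L^p(μ)`. -/
def WeaklyNullLp {Ω : Type*} [MeasurableSpace Ω] (μ : Measure Ω) (p : ℝ≥0∞)
    (f : ℕ → Lp ℝ p μ) : Prop :=
  ∀ q : ℝ≥0∞, p⁻¹ + q⁻¹ = 1 → ∀ g : Lp ℝ q μ,
    Tendsto (fun n => ∫ x, (f n : Ω → ℝ) x * (g : Ω → ℝ) x ∂μ) atTop (nhds 0)

/-- The `p`-modulus of uniform integrability. -/
def omegaP {Ω : Type*} [MeasurableSpace Ω] (μ : Measure Ω) (p : ℝ) (f : Ω → ℝ) (ε : ℝ) : ℝ :=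
  sSup {r : ℝ | ∃ A : Set Ω, MeasurableSet A ∧ μ A ≤ ENNReal.ofReal ε ∧
    r = (∫ x in A, |f x| ^ p ∂μ) ^ (1 / p)}


section Scalar

lemma abs_add_rpow_add_abs_sub_rpow_le {p : ℝ} (hp0 : 0 < p) (hp2 : p ≤ 2) (a b : ℝ) :
    |a + b| ^ p + |a - b| ^ p ≤ 2 * (|a| ^ p + |b| ^ p) := by
  have key : ∀ t : ℝ, |t| ^ p = (t ^ 2) ^ (p / 2) := fun t => by
    rw [← sq_abs, ← Real.rpow_natCast, ← Real.rpow_mul (abs_nonneg t)]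
    congr 1
    push_cast
    ring
  have hconc := (Real.concaveOn_rpow (p := p / 2) (by linarith) (by linarith)).2
    (Set.mem_Ici.2 (sq_nonneg (a + b))) (Set.mem_Ici.2 (sq_nonneg (a - b)))
    (show (0 : ℝ) ≤ 1 / 2 by norm_num) (show (0 : ℝ) ≤ 1 / 2 by norm_num) (by norm_num)
  have hadd := Real.rpow_add_le_add_rpow (sq_nonneg a) (sq_nonneg b)
    (show 0 ≤ p / 2 by linarith) (show p / 2 ≤ 1 by linarith)
  have hmid : (1 / 2 : ℝ) • (a + b) ^ 2 + (1 / 2 : ℝ) • (a - b) ^ 2 = a ^ 2 + b ^ 2 := by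
    simp only [smul_eq_mul]
    ring
  rw [hmid] at hconc
  simp only [smul_eq_mul] at hconc
  rw [key, key, key, key]
  linarith

lemma two_mul_abs_rpow_le {p : ℝ} (hp1 : 1 ≤ p) (a b : ℝ) :
    2 * |a| ^ p ≤ |a + b| ^ p + |a - b| ^ p := by
  have hconv := (convexOn_rpow hp1).2
    (Set.mem_Ici.2 (abs_nonneg (a + b))) (Set.mem_Ici.2 (abs_nonneg (a - b)))
    (show (0 : ℝ) ≤ 1 / 2 by norm_num) (show (0 : ℝ) ≤ 1 / 2 by norm_num) (by norm_num)
  simp only [smul_eq_mul] at hconv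
  have habs : |a| ≤ 1 / 2 * |a + b| + 1 / 2 * |a - b| := by
    have := abs_add_le (a + b) (a - b)
    rw [show a + b + (a - b) = 2 * a by ring, abs_mul, abs_two] at this
    linarith
  have := Real.rpow_le_rpow (abs_nonneg a) habs (show 0 ≤ p by linarith)
  linarith

end Scalar

section Lebesgue

variable {Ω : Type*} [MeasurableSpace Ω] {μ : Measure Ω} {p : ℝ}

lemma Lp.integrable_abs_rpow (hp1 : 1 ≤ p) (f : Lp ℝ (ENNReal.ofReal p) μ) :
    Integrable (fun ω => |f ω| ^ p) μ := by
  have h := (Lp.memLp f).integrable_norm_rpow (by simp; linarith) ENNReal.ofReal_ne_top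
  simpa [ENNReal.toReal_ofReal (zero_le_one.trans hp1)] using h

lemma Lp.norm_rpow_eq_integral (hp1 : 1 ≤ p) (f : Lp ℝ (ENNReal.ofReal p) μ) :
    ‖f‖ ^ p = ∫ ω, |f ω| ^ p ∂μ := by
  have hint : 0 ≤ ∫ ω, |f ω| ^ p ∂μ := integral_nonneg fun _ => by positivity
  rw [Lp.norm_def, (Lp.memLp f).eLpNorm_eq_integral_rpow_norm (by simp; linarith)
    ENNReal.ofReal_ne_top, ENNReal.toReal_ofReal (zero_le_one.trans hp1)]
  simp only [Real.norm_eq_abs]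
  rw [ENNReal.toReal_ofReal (by positivity), Real.rpow_inv_rpow hint (by linarith)]

/-- `f` is within distance `η` of a function bounded by `M`. -/
def BddApprox (M η : ℝ) (f : Lp ℝ (ENNReal.ofReal p) μ) : Prop :=
  ∃ g : Lp ℝ (ENNReal.ofReal p) μ, (∀ᵐ ω ∂μ, |g ω| ≤ M) ∧ ‖f - g‖ ≤ η

lemma BddApprox.mono {M M' η η' : ℝ} {f : Lp ℝ (ENNReal.ofReal p) μ} (h : BddApprox M η f)
    (hM : M ≤ M') (hη : η ≤ η') : BddApprox M' η' f := by
  obtain ⟨g, hg, hfg⟩ := h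
  exact ⟨g, hg.mono fun ω hω => hω.trans hM, hfg.trans hη⟩

lemma Lp.norm_add_rpow_add_norm_sub_rpow (hp1 : 1 ≤ p) (f g : Lp ℝ (ENNReal.ofReal p) μ) :
    ‖f + g‖ ^ p + ‖f - g‖ ^ p = ∫ ω, (|f ω + g ω| ^ p + |f ω - g ω| ^ p) ∂μ := by
  rw [Lp.norm_rpow_eq_integral hp1, Lp.norm_rpow_eq_integral hp1,
    ← integral_add (Lp.integrable_abs_rpow hp1 _) (Lp.integrable_abs_rpow hp1 _)]
  refine integral_congr_ae ?_
  filter_upwards [Lp.coeFn_add f g, Lp.coeFn_sub f g] with ω h1 h2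
  simp only [h1, h2, Pi.add_apply, Pi.sub_apply]

lemma Lp.integrable_abs_add_rpow_add_abs_sub_rpow (hp1 : 1 ≤ p)
    (f g : Lp ℝ (ENNReal.ofReal p) μ) :
    Integrable (fun ω => |f ω + g ω| ^ p + |f ω - g ω| ^ p) μ := by
  refine ((Lp.integrable_abs_rpow hp1 (f + g)).add
    (Lp.integrable_abs_rpow hp1 (f - g))).congr ?_
  filter_upwards [Lp.coeFn_add f g, Lp.coeFn_sub f g] with ω h1 h2
  simp only [h1, h2, Pi.add_apply, Pi.sub_apply]

lemma rpow_mul_measureReal_le_norm_rpow [IsFiniteMeasure μ] (hp1 : 1 ≤ p) {m : ℝ} (hm : 0 ≤ m)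
    (f : Lp ℝ (ENNReal.ofReal p) μ) : m ^ p * μ.real {ω | m < |f ω|} ≤ ‖f‖ ^ p := by
  have hA : MeasurableSet {ω | m < |f ω|} :=
    measurableSet_lt measurable_const (Lp.stronglyMeasurable f).measurable.abs
  rw [Lp.norm_rpow_eq_integral hp1]
  calc m ^ p * μ.real {ω | m < |f ω|} = ∫ _ in {ω | m < |f ω|}, m ^ p ∂μ := by
        rw [setIntegral_const, smul_eq_mul, mul_comm]
    _ ≤ ∫ ω in {ω | m < |f ω|}, |f ω| ^ p ∂μ :=
        setIntegral_mono_on (integrable_const _).integrableOn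
          (Lp.integrable_abs_rpow hp1 f).integrableOn hA
          fun ω hω => Real.rpow_le_rpow hm (le_of_lt hω) (by linarith)
    _ ≤ ∫ ω, |f ω| ^ p ∂μ :=
        setIntegral_le_integral (Lp.integrable_abs_rpow hp1 f)
          (Eventually.of_forall fun _ => by positivity)

lemma Lp.norm_add_rpow_add_norm_sub_rpow_le (hp1 : 1 ≤ p) (hp2 : p ≤ 2)
    (f g : Lp ℝ (ENNReal.ofReal p) μ) :
    ‖f + g‖ ^ p + ‖f - g‖ ^ p ≤ 2 * (‖f‖ ^ p + ‖g‖ ^ p) := by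
  rw [Lp.norm_add_rpow_add_norm_sub_rpow hp1, Lp.norm_rpow_eq_integral hp1 f,
    Lp.norm_rpow_eq_integral hp1 g, ← integral_add (Lp.integrable_abs_rpow hp1 _)
    (Lp.integrable_abs_rpow hp1 _), ← integral_const_mul]
  exact integral_mono (Lp.integrable_abs_add_rpow_add_abs_sub_rpow hp1 f g)
    (((Lp.integrable_abs_rpow hp1 f).add (Lp.integrable_abs_rpow hp1 g)).const_mul 2)
    fun ω => abs_add_rpow_add_abs_sub_rpow_le (by linarith) hp2 (f ω) (g ω)

lemma two_mul_setIntegral_le_norm_rpow (hp1 : 1 ≤ p) (f g : Lp ℝ (ENNReal.ofReal p) μ)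
    {A : Set Ω} (hA : MeasurableSet A) :
    2 * ‖f‖ ^ p + 2 * ∫ ω in A, |g ω| ^ p ∂μ ≤
      ‖f + g‖ ^ p + ‖f - g‖ ^ p + 2 * ∫ ω in A, |f ω| ^ p ∂μ := by
  have hint := Lp.integrable_abs_add_rpow_add_abs_sub_rpow hp1 f g
  rw [Lp.norm_add_rpow_add_norm_sub_rpow hp1, Lp.norm_rpow_eq_integral hp1,
    ← integral_add_compl hA (Lp.integrable_abs_rpow hp1 f), ← integral_add_compl hA hint]
  have h1 : ∫ ω in A, 2 * |g ω| ^ p ∂μ ≤ ∫ ω in A, (|f ω + g ω| ^ p + |f ω - g ω| ^ p) ∂μ :=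
    integral_mono ((Lp.integrable_abs_rpow hp1 g).const_mul 2).integrableOn hint.integrableOn
      fun ω => by
        have := two_mul_abs_rpow_le hp1 (g ω) (f ω)
        rwa [add_comm (g ω), abs_sub_comm (g ω)] at this
  have h2 : ∫ ω in Aᶜ, 2 * |f ω| ^ p ∂μ ≤ ∫ ω in Aᶜ, (|f ω + g ω| ^ p + |f ω - g ω| ^ p) ∂μ :=
    integral_mono ((Lp.integrable_abs_rpow hp1 f).const_mul 2).integrableOn hint.integrableOn
      fun ω => two_mul_abs_rpow_le hp1 (f ω) (g ω)
  rw [integral_const_mul] at h1 h2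
  linarith

variable [Fact (1 ≤ ENNReal.ofReal p)]

lemma BddApprox.sum {ι : Type*} (s : Finset ι) {M η : ι → ℝ}
    {f : ι → Lp ℝ (ENNReal.ofReal p) μ} (h : ∀ i ∈ s, BddApprox (M i) (η i) (f i)) :
    BddApprox (∑ i ∈ s, M i) (∑ i ∈ s, η i) (∑ i ∈ s, f i) := by
  classical
  induction s using Finset.induction_on with
  | empty =>
    refine ⟨0, ?_, by simp⟩
    filter_upwards [Lp.coeFn_zero ℝ (ENNReal.ofReal p) μ] with ω hω
    simp only [Finset.sum_empty, hω, Pi.zero_apply, abs_zero, le_refl]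
  | insert i s hi ih =>
    obtain ⟨g, hg, hfg⟩ := ih fun k hk => h k (Finset.mem_insert_of_mem hk)
    obtain ⟨g', hg', hfg'⟩ := h i (Finset.mem_insert_self i s)
    rw [Finset.sum_insert hi, Finset.sum_insert hi, Finset.sum_insert hi]
    refine ⟨g' + g, ?_, ?_⟩
    · filter_upwards [hg, hg', Lp.coeFn_add g' g] with ω h1 h2 h3
      rw [h3]
      exact (abs_add_le _ _).trans (add_le_add h2 h1)
    · rw [add_sub_add_comm]
      exact (norm_add_le _ _).trans (add_le_add hfg' hfg)

lemma BddApprox.smul {M η ε : ℝ} {f : Lp ℝ (ENNReal.ofReal p) μ} (h : BddApprox M η f)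
    (hε : |ε| = 1) : BddApprox M η (ε • f) := by
  obtain ⟨g, hg, hfg⟩ := h
  refine ⟨ε • g, ?_, ?_⟩
  · filter_upwards [hg, Lp.coeFn_smul ε g] with ω h1 h2
    simpa [h2, abs_mul, hε] using h1
  · rw [← smul_sub, norm_smul, Real.norm_eq_abs, hε, one_mul]
    exact hfg

lemma exists_bddApprox (f : Lp ℝ (ENNReal.ofReal p) μ) {η : ℝ} (hη : 0 < η) :
    ∃ M, BddApprox M η f := by
  obtain ⟨g, hg⟩ := (Lp.simpleFunc.denseRange (E := ℝ) (μ := μ)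
    (p := ENNReal.ofReal p) ENNReal.ofReal_ne_top).exists_dist_lt f hη
  obtain ⟨M, hM⟩ := (Lp.simpleFunc.toSimpleFunc g).exists_forall_norm_le
  refine ⟨M, g, ?_, by simpa [dist_eq_norm] using hg.le⟩
  filter_upwards [Lp.simpleFunc.toSimpleFunc_eq_toFun g] with ω hω
  rw [← hω]
  exact hM ω

lemma rpow_lt_setIntegral_of_not_bddApprox (hp1 : 1 ≤ p) {m δ : ℝ} (hm : 0 ≤ m) (hδ : 0 ≤ δ)
    {f : Lp ℝ (ENNReal.ofReal p) μ} (hf : ¬ BddApprox m δ f) :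
    δ ^ p < ∫ ω in {ω | m < |f ω|}, |f ω| ^ p ∂μ := by
  have hA : MeasurableSet {ω | m < |f ω|} :=
    measurableSet_lt measurable_const (Lp.stronglyMeasurable f).measurable.abs
  set A := {ω | m < |f ω|} with hAdef
  by_contra! hle
  refine hf ⟨((Lp.memLp f).indicator hA.compl).toLp _, ?_, ?_⟩
  · filter_upwards [((Lp.memLp f).indicator hA.compl).coeFn_toLp] with ω hω
    rw [hω]
    by_cases h : ω ∈ A
    · simpa [h] using hm
    · simpa [h] using not_lt.1 h
  · rw [← Real.rpow_le_rpow_iff (norm_nonneg _) hδ (zero_lt_one.trans_le hp1),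
      Lp.norm_rpow_eq_integral hp1]
    refine le_trans (le_of_eq ?_) hle
    rw [← integral_indicator hA]
    refine integral_congr_ae ?_
    filter_upwards [((Lp.memLp f).indicator hA.compl).coeFn_toLp,
      Lp.coeFn_sub f (((Lp.memLp f).indicator hA.compl).toLp _)] with ω h1 h2
    rw [h2, Pi.sub_apply, h1]
    by_cases h : ω ∈ A
    · simp [h]
    · simp [h, Real.zero_rpow (by linarith : p ≠ 0)]

lemma BddApprox.setIntegral_le [IsFiniteMeasure μ] (hp1 : 1 ≤ p) (hp2 : p ≤ 2) {M η : ℝ}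
    {f : Lp ℝ (ENNReal.ofReal p) μ} (hf : BddApprox M η f) (A : Set Ω) :
    ∫ ω in A, |f ω| ^ p ∂μ ≤ 2 * (|M| ^ p * μ.real A + η ^ p) := by
  obtain ⟨g, hg, hfg⟩ := hf
  have hd := Lp.integrable_abs_rpow hp1 (f - g)
  have hpt : ∀ᵐ ω ∂μ, |f ω| ^ p ≤ 2 * (|M| ^ p + |(f - g) ω| ^ p) := by
    filter_upwards [hg, Lp.coeFn_sub f g] with ω h1 h2
    have h3 := abs_add_rpow_add_abs_sub_rpow_le (p := p) (by linarith) hp2 (g ω) ((f - g) ω)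
    have h4 : 0 ≤ |g ω - (f - g) ω| ^ p := by positivity
    have h5 : |g ω| ^ p ≤ |M| ^ p :=
      Real.rpow_le_rpow (abs_nonneg _) (h1.trans (le_abs_self M)) (by linarith)
    have h6 : g ω + (f - g) ω = f ω := by
      rw [h2, Pi.sub_apply]
      ring
    rw [h6] at h3
    linarith
  calc ∫ ω in A, |f ω| ^ p ∂μ ≤ ∫ ω in A, 2 * (|M| ^ p + |(f - g) ω| ^ p) ∂μ :=
        setIntegral_mono_ae (Lp.integrable_abs_rpow hp1 f).integrableOn
          (((integrable_const _).add hd).const_mul 2).integrableOn hpt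
    _ = 2 * (|M| ^ p * μ.real A + ∫ ω in A, |(f - g) ω| ^ p ∂μ) := by
        rw [integral_const_mul, integral_add (integrable_const _) hd.integrableOn,
          setIntegral_const, smul_eq_mul, mul_comm (μ.real A)]
    _ ≤ 2 * (|M| ^ p * μ.real A + η ^ p) := by
        have h1 : ∫ ω in A, |(f - g) ω| ^ p ∂μ ≤ ∫ ω, |(f - g) ω| ^ p ∂μ :=
          setIntegral_le_integral hd (Eventually.of_forall fun _ => by positivity)
        have h2 := Real.rpow_le_rpow (norm_nonneg _) hfg (show 0 ≤ p by linarith)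
        rw [Lp.norm_rpow_eq_integral hp1] at h2
        linarith

/-- If `f` is nearly bounded and `g` has a large part on a small set, then some choice of sign
makes the `p`-th power of the norm of `f ± g` exceed that of `f` by a fixed amount. -/
lemma exists_sign_norm_rpow_add_le [IsFiniteMeasure μ] (hp1 : 1 ≤ p) (hp2 : p ≤ 2) {C δ : ℝ}
    (hC : 0 ≤ C) (hδ : 0 < δ) :
    ∃ η, 0 < η ∧ ∀ M : ℝ, ∃ m : ℝ, ∀ f g : Lp ℝ (ENNReal.ofReal p) μ, ‖g‖ ≤ C →
      BddApprox M η f → ¬ BddApprox m δ g →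
      ∃ ε : ℝ, |ε| = 1 ∧ ‖f‖ ^ p + δ ^ p / 2 ≤ ‖f + ε • g‖ ^ p := by
  have hp0 : 0 < p := by linarith
  have hpow : ∀ t : ℝ, 0 ≤ t → (t / 8) ^ p ≤ t ^ p / 8 := fun t ht => by
    rw [Real.div_rpow ht (by norm_num)]
    gcongr
    calc (8 : ℝ) = 8 ^ (1 : ℝ) := (Real.rpow_one 8).symm
      _ ≤ 8 ^ p := Real.rpow_le_rpow_of_exponent_le (by norm_num) hp1
  refine ⟨δ / 8, by positivity, fun M => ?_⟩
  set m : ℝ := 8 * (|M| * C) / δ + 1 with hm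
  have hm0 : 0 < m := by positivity
  refine ⟨m, fun f g hg hf hgm => ?_⟩
  have hA : MeasurableSet {ω | m < |g ω|} :=
    measurableSet_lt measurable_const (Lp.stronglyMeasurable g).measurable.abs
  have h1 := two_mul_setIntegral_le_norm_rpow hp1 f g hA
  have h2 := rpow_lt_setIntegral_of_not_bddApprox hp1 hm0.le hδ.le hgm
  have h3 := hf.setIntegral_le hp1 hp2 {ω | m < |g ω|}
  have h4 := rpow_mul_measureReal_le_norm_rpow hp1 hm0.le g
  have h5 := hpow δ hδ.le
  have h6 : |M| ^ p * μ.real {ω | m < |g ω|} ≤ δ ^ p / 8 := by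
    have hle : |M| * C ≤ m * (δ / 8) := by
      have : m * (δ / 8) = |M| * C + δ / 8 := by
        rw [hm]
        field_simp
      linarith
    have h7 := Real.rpow_le_rpow (by positivity) hle hp0.le
    rw [Real.mul_rpow (abs_nonneg M) hC, Real.mul_rpow hm0.le (by positivity)] at h7
    have h8 : ‖g‖ ^ p ≤ C ^ p := Real.rpow_le_rpow (norm_nonneg _) hg hp0.le
    refine le_of_mul_le_mul_left ?_ (Real.rpow_pos_of_pos hm0 p)
    calc m ^ p * (|M| ^ p * μ.real {ω | m < |g ω|})
        = |M| ^ p * (m ^ p * μ.real {ω | m < |g ω|}) := by ring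
      _ ≤ |M| ^ p * C ^ p := by gcongr; exact h4.trans h8
      _ ≤ m ^ p * (δ / 8) ^ p := h7
      _ ≤ m ^ p * (δ ^ p / 8) := by gcongr
  by_cases hs : ‖f‖ ^ p + δ ^ p / 2 ≤ ‖f + g‖ ^ p
  · exact ⟨1, abs_one, by rwa [one_smul]⟩
  · refine ⟨-1, by simp, ?_⟩
    rw [neg_one_smul, ← sub_eq_add_neg]
    linarith

/-- Signed sums of a family with large parts on small sets grow like `n ^ (1 / p)`, so such
families do not satisfy an upper `ℓ²` estimate. -/
lemma exists_frequently_bddApprox [IsFiniteMeasure μ] (hp1 : 1 ≤ p) (hp2 : p < 2)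
    {β : Type*} {U : Filter ℕ} [U.NeBot] (hU : U ≤ cofinite) {V : Filter β} [V.NeBot]
    {x : ℕ → β → Lp ℝ (ENNReal.ofReal p) μ} {C : ℝ} (hC : 0 ≤ C)
    (hx : ∀ b (s : Finset ℕ) (ε : ℕ → ℝ), (∀ i, |ε i| = 1) →
      ‖∑ i ∈ s, ε i • x i b‖ ≤ C * (s.card : ℝ) ^ (1 / 2 : ℝ))
    (happrox : ∀ i, ∀ η > 0, ∃ M, ∀ᶠ b in V, BddApprox M η (x i b)) {δ : ℝ} (hδ : 0 < δ) :
    ∃ m, ∃ᶠ i in U, ∃ᶠ b in V, BddApprox m δ (x i b) := by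
  by_contra hbad
  simp only [not_exists, not_frequently] at hbad
  have hp0 : 0 < p := by linarith
  obtain ⟨η, hη, hstep⟩ := exists_sign_norm_rpow_add_le (μ := μ) hp1 hp2.le hC hδ
  have hnorm : ∀ i b, ‖x i b‖ ≤ C := fun i b => by
    simpa using hx b {i} (fun _ => 1) (by simp)
  have hgrow : ∀ n : ℕ, ∃ s : Finset ℕ, s.card = n ∧ ∀ᶠ b in V, ∃ ε : ℕ → ℝ,
      (∀ i, |ε i| = 1) ∧ n * (δ ^ p / 2) ≤ ‖∑ i ∈ s, ε i • x i b‖ ^ p := by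
    intro n
    induction n with
    | zero => exact ⟨∅, rfl, Eventually.of_forall fun b => ⟨fun _ => 1, by simp, by
        simp [Real.zero_rpow hp0.ne']⟩⟩
    | succ n ih =>
      obtain ⟨s, hs, hsb⟩ := ih
      choose M hM using fun i => happrox i (η / (n + 1)) (by positivity)
      obtain ⟨m, hm⟩ := hstep (∑ i ∈ s, M i)
      obtain ⟨i, hib, his⟩ := ((hbad m).and
        (hU s.finite_toSet.compl_mem_cofinite)).exists
      have his : i ∉ s := his
      refine ⟨insert i s, by rw [Finset.card_insert_of_notMem his, hs], ?_⟩
      filter_upwards [hsb, hib, (Filter.eventually_all_finset s).2 fun k _ => hM k]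
        with b ⟨ε, hε, hεb⟩ hib hMb
      have hsum : BddApprox (∑ k ∈ s, M k) η (∑ k ∈ s, ε k • x k b) := by
        refine (BddApprox.sum s fun k hk => (hMb k hk).smul (hε k)).mono le_rfl ?_
        rw [Finset.sum_const, hs, nsmul_eq_mul, mul_div_assoc', div_le_iff₀ (by positivity)]
        linarith
      obtain ⟨e, he, hle⟩ := hm _ _ (hnorm i b) hsum hib
      refine ⟨Function.update ε i e, fun k => ?_, ?_⟩
      · by_cases hk : k = i
        · simp [hk, he]
        · simp [hk, hε]
      · have hcongr : ∑ k ∈ s, Function.update ε i e k • x k b = ∑ k ∈ s, ε k • x k b :=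
          Finset.sum_congr rfl fun k hk => by
            rw [Function.update_of_ne (ne_of_mem_of_not_mem hk his)]
        rw [Finset.sum_insert his, hcongr, Function.update_self, add_comm (e • x i b)]
        push_cast
        linarith
  have hle : ∀ n : ℕ, n * (δ ^ p / 2) ≤ C ^ p * (n : ℝ) ^ (p / 2) := by
    intro n
    obtain ⟨s, hs, hsb⟩ := hgrow n
    obtain ⟨b, ε, hε, hb⟩ := hsb.exists
    refine hb.trans ((Real.rpow_le_rpow (norm_nonneg _) (hx b s ε hε) hp0.le).trans_eq ?_)
    rw [hs, Real.mul_rpow hC (by positivity), ← Real.rpow_mul (by positivity)]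
    congr 2
    ring
  have hlim : Tendsto (fun n : ℕ => (n : ℝ) ^ (1 - p / 2)) atTop atTop :=
    (tendsto_rpow_atTop (by linarith)).comp tendsto_natCast_atTop_atTop
  obtain ⟨n, hn, hn0⟩ := ((hlim.eventually_gt_atTop (C ^ p / (δ ^ p / 2))).and
    (eventually_gt_atTop 0)).exists
  have hn0 : (0 : ℝ) < n := by exact_mod_cast hn0
  rw [div_lt_iff₀ (by positivity)] at hn
  have hmul := mul_lt_mul_of_pos_right hn (Real.rpow_pos_of_pos hn0 (p / 2))
  rw [mul_right_comm, ← Real.rpow_add hn0, sub_add_cancel, Real.rpow_one] at hmul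
  exact absurd (hle n) (not_le.2 hmul)

end Lebesgue

section Signs

lemma exists_signs_le_sum {V : Type*} [AddCommGroup V] [Module ℝ V] {Φ : V → ℝ} (h0 : Φ 0 ≤ 0)
    (hΦ : ∀ a b, Φ (a + b) + Φ (a - b) ≤ 2 * (Φ a + Φ b)) (z : ℕ → V) (n : ℕ) :
    ∃ ε : ℕ → ℝ, (∀ k, |ε k| = 1) ∧
      Φ (∑ k ∈ Finset.range n, ε k • z k) ≤ ∑ k ∈ Finset.range n, Φ (z k) := by
  induction n with
  | zero => exact ⟨fun _ => 1, by simp, by simpa using h0⟩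
  | succ n ih =>
    obtain ⟨ε, hε, hle⟩ := ih
    obtain ⟨e, he, hen⟩ : ∃ e : ℝ, |e| = 1 ∧
        Φ (∑ k ∈ Finset.range n, ε k • z k + e • z n) ≤
          Φ (∑ k ∈ Finset.range n, ε k • z k) + Φ (z n) := by
      have h := hΦ (∑ k ∈ Finset.range n, ε k • z k) (z n)
      by_cases hs : Φ (∑ k ∈ Finset.range n, ε k • z k + z n) ≤
          Φ (∑ k ∈ Finset.range n, ε k • z k) + Φ (z n)
      · exact ⟨1, abs_one, by rwa [one_smul]⟩
      · refine ⟨-1, by simp, ?_⟩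
        rw [neg_one_smul, ← sub_eq_add_neg]
        linarith
    refine ⟨Function.update ε n e, fun k => ?_, ?_⟩
    · by_cases hk : k = n
      · simp [hk, he]
      · simp [hk, hε]
    · have hcongr : ∑ k ∈ Finset.range n, Function.update ε n e k • z k =
          ∑ k ∈ Finset.range n, ε k • z k :=
        Finset.sum_congr rfl fun k hk => by
          rw [Function.update_of_ne (Finset.mem_range.1 hk).ne]
      rw [Finset.sum_range_succ, Finset.sum_range_succ, hcongr, Function.update_self]
      linarith

end Signs

section Upper

variable {Ω : Type*} [MeasurableSpace Ω] {μ : Measure Ω} [IsProbabilityMeasure μ] {p : ℝ}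

/-- An element of `L^2` whose image in `L^p` is `g`. -/
lemma exists_lp_two_of_ae_bound {M : ℝ} (hM : 0 ≤ M) {g : Lp ℝ (ENNReal.ofReal p) μ}
    (hg : ∀ᵐ ω ∂μ, |g ω| ≤ M) :
    ∃ h : Lp ℝ 2 μ, (h : Ω →ₘ[μ] ℝ) = (g : Ω →ₘ[μ] ℝ) ∧ ‖h‖ ≤ M := by
  have hmem : MemLp (g : Ω → ℝ) 2 μ := MemLp.of_bound (Lp.aestronglyMeasurable g) M hg
  refine ⟨hmem.toLp _, ?_, ?_⟩
  · rw [MemLp.toLp_val, AEEqFun.mk_coeFn]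
  · refine (Lp.norm_le_of_ae_bound hM ?_).trans_eq (by simp [measureUnivNNReal])
    filter_upwards [hmem.coeFn_toLp, hg] with ω h1 h2
    rwa [h1]

lemma norm_le_norm_lp_two (hp2 : p ≤ 2) {g : Lp ℝ (ENNReal.ofReal p) μ} {h : Lp ℝ 2 μ}
    (hgh : (h : Ω →ₘ[μ] ℝ) = (g : Ω →ₘ[μ] ℝ)) : ‖g‖ ≤ ‖h‖ := by
  rw [Lp.norm_def, Lp.norm_def, hgh]
  refine ENNReal.toReal_mono ?_ (eLpNorm_le_eLpNorm_of_exponent_le ?_ (Lp.aestronglyMeasurable g))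
  · rw [← hgh]
    exact Lp.eLpNorm_ne_top h
  · exact ENNReal.ofReal_le_of_le_toReal (by simpa using hp2)

variable [Fact (1 ≤ ENNReal.ofReal p)]

/-- Signed sums of nearly bounded functions are small for some choice of signs. -/
lemma exists_signs_norm_sum_le (hp1 : 1 ≤ p) (hp2 : p ≤ 2) {M η : ℝ} (hM : 0 < M) (hη : 0 < η)
    {y : ℕ → Lp ℝ (ENNReal.ofReal p) μ} (hy : ∀ k, BddApprox M η (y k)) (n : ℕ) :
    ∃ ε : ℕ → ℝ, (∀ k, |ε k| = 1) ∧ ‖∑ k ∈ Finset.range n, ε k • y k‖ ≤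
      M * (2 * n : ℝ) ^ (1 / 2 : ℝ) + η * (2 * n : ℝ) ^ (1 / p) := by
  have hp0 : 0 < p := by linarith
  choose g hg hgy using hy
  choose h hhg hh using fun k => exists_lp_two_of_ae_bound hM.le (hg k)
  obtain ⟨ε, hε, hle⟩ := exists_signs_le_sum
    (Φ := fun z : Lp ℝ 2 μ × Lp ℝ (ENNReal.ofReal p) μ =>
      ‖z.1‖ ^ 2 / M ^ 2 + ‖z.2‖ ^ p / η ^ p)
    (by simp [Real.zero_rpow hp0.ne']) (fun a b => by
      have h1 := parallelogram_law_with_norm ℝ a.1 b.1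
      have h2 := Lp.norm_add_rpow_add_norm_sub_rpow_le hp1 hp2 a.2 b.2
      have h3 : (‖a.1 + b.1‖ ^ 2 + ‖a.1 - b.1‖ ^ 2) / M ^ 2 ≤
          2 * (‖a.1‖ ^ 2 + ‖b.1‖ ^ 2) / M ^ 2 := by rw [h1]
      have h4 : (‖a.2 + b.2‖ ^ p + ‖a.2 - b.2‖ ^ p) / η ^ p ≤
          2 * (‖a.2‖ ^ p + ‖b.2‖ ^ p) / η ^ p := by gcongr
      simp only [Prod.fst_add, Prod.snd_add, Prod.fst_sub, Prod.snd_sub]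
      calc _ = (‖a.1 + b.1‖ ^ 2 + ‖a.1 - b.1‖ ^ 2) / M ^ 2 +
            (‖a.2 + b.2‖ ^ p + ‖a.2 - b.2‖ ^ p) / η ^ p := by ring
        _ ≤ _ := add_le_add h3 h4
        _ = _ := by ring)
    (fun k => (h k, y k - g k)) n
  have hterm : ∑ k ∈ Finset.range n,
      (‖h k‖ ^ 2 / M ^ 2 + ‖y k - g k‖ ^ p / η ^ p) ≤ 2 * n := by
    refine (Finset.sum_le_card_nsmul _ _ 2 fun k _ => ?_).trans_eq (by simp [mul_comm])
    have h1 : ‖h k‖ ^ 2 / M ^ 2 ≤ 1 :=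
      div_le_one_of_le₀ (pow_le_pow_left₀ (norm_nonneg _) (hh k) 2) (by positivity)
    have h2 : ‖y k - g k‖ ^ p / η ^ p ≤ 1 :=
      div_le_one_of_le₀ (Real.rpow_le_rpow (norm_nonneg _) (hgy k) hp0.le) (by positivity)
    linarith
  have htot := hle.trans hterm
  simp only [Prod.fst_sum, Prod.snd_sum, Prod.smul_fst, Prod.smul_snd] at htot
  set a := ∑ k ∈ Finset.range n, ε k • h k with ha
  set b := ∑ k ∈ Finset.range n, ε k • (y k - g k) with hb
  have ha0 : 0 ≤ ‖a‖ ^ 2 / M ^ 2 := by positivity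
  have hb0 : 0 ≤ ‖b‖ ^ p / η ^ p := by positivity
  have ha1 : ‖a‖ ≤ M * (2 * n : ℝ) ^ (1 / 2 : ℝ) := by
    rw [← div_le_iff₀' hM, ← Real.sqrt_eq_rpow]
    refine Real.le_sqrt_of_sq_le ?_
    rw [div_pow]
    linarith
  have hb1 : ‖b‖ ≤ η * (2 * n : ℝ) ^ (1 / p) := by
    rw [← div_le_iff₀' hη, one_div, Real.le_rpow_inv_iff_of_pos (by positivity) (by positivity) hp0,
      Real.div_rpow (norm_nonneg _) hη.le]
    linarith
  have hag : ‖∑ k ∈ Finset.range n, ε k • g k‖ ≤ ‖a‖ := by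
    refine norm_le_norm_lp_two hp2 ?_
    rw [ha, AddSubgroup.val_finsetSum, AddSubgroup.val_finsetSum]
    refine Finset.sum_congr rfl fun k _ => ?_
    change ε k • (h k : Ω →ₘ[μ] ℝ) = ε k • (g k : Ω →ₘ[μ] ℝ)
    rw [hhg k]
  refine ⟨ε, hε, ?_⟩
  have hsplit : ∑ k ∈ Finset.range n, ε k • y k = ∑ k ∈ Finset.range n, ε k • g k + b := by
    rw [hb, ← Finset.sum_add_distrib]
    refine Finset.sum_congr rfl fun k _ => ?_
    rw [← smul_add, add_sub_cancel]
  rw [hsplit]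
  exact (norm_add_le _ _).trans (add_le_add (hag.trans ha1) hb1)

lemma IsUnconditionalWith.norm_sum_le {E : Type*} [NormedAddCommGroup E] [NormedSpace ℝ E]
    {u : ℝ} {y : ℕ → E} (hy : IsUnconditionalWith u y) (s : Finset ℕ) {ε : ℕ → ℝ}
    (hε : ∀ k, |ε k| = 1) : ‖∑ k ∈ s, y k‖ ≤ u * ‖∑ k ∈ s, ε k • y k‖ := by
  have h := hy s ε ε fun k _ => hε k
  have hsq : ∀ k, ε k * ε k = 1 := fun k => by rw [← abs_mul_abs_self, hε k, one_mul]
  simpa [hsq] using h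

/-- Unconditional sequences that are uniformly approximable by bounded functions have sums of
order `o(n ^ (1 / p))`. -/
lemma IsUnconditional.tendsto_rpow_mul_norm_sum (hp1 : 1 ≤ p) (hp2 : p < 2)
    {y : ℕ → Lp ℝ (ENNReal.ofReal p) μ} (hy : IsUnconditional y)
    (happrox : ∀ η > 0, ∃ M, ∀ k, BddApprox M η (y k)) :
    Tendsto (fun n : ℕ => (n : ℝ) ^ (-(1 / p)) * ‖∑ k ∈ Finset.range n, y k‖) atTop (nhds 0) := by
  have hp0 : 0 < p := by linarith
  obtain ⟨u, hu1, hu⟩ := hy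
  have hu0 : 0 < u := by linarith
  rw [Metric.tendsto_nhds]
  intro e he
  obtain ⟨M, hM⟩ := happrox (e / (4 * u)) (by positivity)
  have hlim : Tendsto (fun n : ℕ => u * (max M 1) * 2 ^ (1 / 2 : ℝ) *
      (n : ℝ) ^ (-(1 / p - 1 / 2))) atTop (nhds 0) := by
    have hlt : 0 < 1 / p - 1 / 2 := sub_pos.2 (one_div_lt_one_div_of_lt hp0 hp2)
    simpa using ((tendsto_rpow_neg_atTop hlt).comp tendsto_natCast_atTop_atTop).const_mul
      (u * (max M 1) * 2 ^ (1 / 2 : ℝ))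
  filter_upwards [hlim.eventually_lt_const (half_pos he), eventually_gt_atTop 0] with n hn hn0
  have hn0 : (0 : ℝ) < n := by exact_mod_cast hn0
  obtain ⟨ε, hε, hle⟩ := exists_signs_norm_sum_le (M := max M 1) hp1 hp2.le (by positivity)
    (show 0 < e / (4 * u) by positivity) (fun k => (hM k).mono (le_max_left _ _) le_rfl) n
  have hsum := (hu.norm_sum_le (Finset.range n) hε).trans (mul_le_mul_of_nonneg_left hle hu0.le)
  have h2 : (2 : ℝ) ^ (1 / p) ≤ 2 := by
    calc (2 : ℝ) ^ (1 / p) ≤ 2 ^ (1 : ℝ) := Real.rpow_le_rpow_of_exponent_le (by norm_num)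
          ((div_le_one hp0).2 hp1)
      _ = 2 := Real.rpow_one 2
  have hnp : (n : ℝ) ^ (-(1 / p)) * (n : ℝ) ^ (1 / p) = 1 := by
    rw [← Real.rpow_add hn0]
    simp
  have hn2 : (n : ℝ) ^ (-(1 / p)) * (n : ℝ) ^ (1 / 2 : ℝ) = (n : ℝ) ^ (-(1 / p - 1 / 2)) := by
    rw [← Real.rpow_add hn0]
    ring_nf
  rw [dist_zero_right, Real.norm_eq_abs, abs_of_nonneg (by positivity)]
  calc (n : ℝ) ^ (-(1 / p)) * ‖∑ k ∈ Finset.range n, y k‖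
      ≤ (n : ℝ) ^ (-(1 / p)) * (u * (max M 1 * (2 * n : ℝ) ^ (1 / 2 : ℝ) +
          e / (4 * u) * (2 * n : ℝ) ^ (1 / p))) := by gcongr
    _ = u * (max M 1) * 2 ^ (1 / 2 : ℝ) * ((n : ℝ) ^ (-(1 / p)) * (n : ℝ) ^ (1 / 2 : ℝ)) +
          e / 4 * 2 ^ (1 / p) * ((n : ℝ) ^ (-(1 / p)) * (n : ℝ) ^ (1 / p)) := by
        rw [Real.mul_rpow (by norm_num) hn0.le, Real.mul_rpow (by norm_num) hn0.le]
        field_simp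
    _ < e / 2 + e / 4 * 2 := by
        rw [hnp, hn2, mul_one]
        exact add_lt_add_of_lt_of_le hn (mul_le_mul_of_nonneg_left h2 (by positivity))
    _ = e := by ring

end Upper

lemma IsLqBasisEquiv.norm_sum_signs_le {E : Type*} [NormedAddCommGroup E] [NormedSpace ℝ E]
    {C : ℝ} {y : ℕ → E} (hy : IsLqBasisEquiv 2 C y) (s : Finset ℕ) {ε : ℕ → ℝ}
    (hε : ∀ k, |ε k| = 1) : ‖∑ k ∈ s, ε k • y k‖ ≤ C * (s.card : ℝ) ^ (1 / 2 : ℝ) := by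
  simpa [hε] using (hy s ε).2

lemma exists_strictMono_pair {P : ℕ → ℕ → ℕ → Prop}
    (hP : ∀ k N, ∃ i > N, ∃ j > N, P k i j) :
    ∃ i j : ℕ → ℕ, StrictMono i ∧ StrictMono j ∧ ∀ k, P k (i k) (j k) := by
  choose F hF G hG hFG using hP
  let s : ℕ → ℕ × ℕ := fun k => Nat.rec (F 0 0, G 0 0)
    (fun k q => (F (k + 1) (max q.1 q.2), G (k + 1) (max q.1 q.2))) k
  refine ⟨fun k => (s k).1, fun k => (s k).2, strictMono_nat_of_lt_succ fun k => ?_,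
    strictMono_nat_of_lt_succ fun k => ?_, fun k => ?_⟩
  · exact (le_max_left _ _).trans_lt (hF (k + 1) (max (s k).1 (s k).2))
  · exact (le_max_right _ _).trans_lt (hG (k + 1) (max (s k).1 (s k).2))
  · cases k with
    | zero => exact hFG 0 0
    | succ k => exact hFG (k + 1) (max (s k).1 (s k).2)

/-- A matrix with upper `ℓ²` estimates on rows and columns has a generalized diagonal that is
uniformly approximable by bounded functions. -/
lemma exists_diagonal_bddApprox {Ω : Type*} [MeasurableSpace Ω] {μ : Measure Ω}
    [IsFiniteMeasure μ] {p : ℝ} (hp1 : 1 ≤ p) (hp2 : p < 2) [Fact (1 ≤ ENNReal.ofReal p)]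
    {x : ℕ → ℕ → Lp ℝ (ENNReal.ofReal p) μ} {C : ℝ} (hC : 0 ≤ C)
    (hrow : ∀ i, IsLqBasisEquiv 2 C fun j => x i j)
    (hcol : ∀ j, IsLqBasisEquiv 2 C fun i => x i j) :
    ∃ i j : ℕ → ℕ, StrictMono i ∧ StrictMono j ∧
      ∀ η > 0, ∃ M, ∀ k, BddApprox M η (x (i k) (j k)) := by
  let U : Ultrafilter ℕ := hyperfilter ℕ
  have hU : (U : Filter ℕ) ≤ cofinite := hyperfilter_le_cofinite
  have hrowU : ∀ i, ∀ η > 0, ∃ M, ∀ᶠ j in (U : Filter ℕ), BddApprox M η (x i j) := by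
    intro i η hη
    obtain ⟨M, hM⟩ := exists_frequently_bddApprox hp1 hp2 hU (V := (⊤ : Filter Unit))
      (x := fun j _ => x i j) hC (fun _ s ε hε => (hrow i).norm_sum_signs_le s hε)
      (fun j η hη => (exists_bddApprox (x i j) hη).imp fun M hM => Eventually.of_forall fun _ => hM)
      hη
    refine ⟨M, (Ultrafilter.frequently_iff_eventually.1 hM).mono fun j hj => ?_⟩
    simpa using hj
  have hmat : ∀ r : ℕ, ∃ M, ∀ᶠ i in (U : Filter ℕ), ∀ᶠ j in (U : Filter ℕ),
      BddApprox M (1 / ((r : ℝ) + 1)) (x i j) := by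
    intro r
    obtain ⟨M, hM⟩ := exists_frequently_bddApprox hp1 hp2 hU (V := (U : Filter ℕ)) hC
      (fun j s ε hε => (hcol j).norm_sum_signs_le s hε) hrowU
      (show (0 : ℝ) < 1 / ((r : ℝ) + 1) by positivity)
    exact ⟨M, (Ultrafilter.frequently_iff_eventually.1 hM).mono fun i hi =>
      Ultrafilter.frequently_iff_eventually.1 hi⟩
  choose M hM using hmat
  have hgt : ∀ N, ∀ᶠ i in (U : Filter ℕ), N < i := fun N =>
    (eventually_gt_atTop N).filter_mono Nat.hyperfilter_le_atTop
  obtain ⟨i, j, hi, hj, hij⟩ := exists_strictMono_pair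
    (P := fun k i j => ∀ r ∈ Finset.range (k + 1), BddApprox (M r) (1 / ((r : ℝ) + 1)) (x i j))
    (fun k N => by
      obtain ⟨i, hi, hiN⟩ := (((Filter.eventually_all_finset (Finset.range (k + 1))).2
        fun r _ => hM r).and (hgt N)).exists
      obtain ⟨j, hj, hjN⟩ := (((Filter.eventually_all_finset (Finset.range (k + 1))).2
        hi).and (hgt N)).exists
      exact ⟨i, hiN, j, hjN, hj⟩)
  refine ⟨i, j, hi, hj, fun η hη => ?_⟩
  obtain ⟨r, hr⟩ := exists_nat_one_div_lt hη
  choose L hL using fun k => exists_bddApprox (x (i k) (j k)) hη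
  obtain ⟨B, hB⟩ := ((Finset.range r).image L).bddAbove
  refine ⟨max (M r) B, fun k => ?_⟩
  by_cases hk : k < r
  · exact (hL k).mono ((hB (by simpa using ⟨k, hk, rfl⟩)).trans (le_max_right _ _)) le_rfl
  · exact (hij k r (Finset.mem_range.2 (by omega))).mono (le_max_left _ _) hr.le

/-- (Commutative case of Theorem 1.1.) -/
theorem statement0
    {Ω : Type*} [MeasurableSpace Ω] (μ : Measure Ω) [IsProbabilityMeasure μ]
    (hμ : Atomless μ)
    (p : ℝ) (hp1 : 1 ≤ p) (hp2 : p < 2)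
    [Fact (1 ≤ ENNReal.ofReal p)]
    (x : ℕ → ℕ → Lp ℝ (ENNReal.ofReal p) μ)
    (C : ℝ) (hC : 1 ≤ C)
    (hrow : ∀ i, IsLqBasisEquiv 2 C fun j => x i j)
    (hcol : ∀ j, IsLqBasisEquiv 2 C fun i => x i j)
    (hdiag : ∀ i j : ℕ → ℕ, StrictMono i → StrictMono j →
      IsUnconditional fun k => x (i k) (j k)) :
    ∃ i j : ℕ → ℕ, StrictMono i ∧ StrictMono j ∧
      ∀ k : ℕ → ℕ, StrictMono k →
        Tendsto
          (fun n : ℕ => (n : ℝ) ^ (-(1 / p)) * ‖∑ m ∈ Finset.range n, x (i (k m)) (j (k m))‖)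
          atTop (nhds 0) := by
  obtain ⟨i, j, hi, hj, hij⟩ :=
    exists_diagonal_bddApprox hp1 hp2 (zero_le_one.trans hC) hrow hcol
  refine ⟨i, j, hi, hj, fun k hk => ?_⟩
  exact (hdiag _ _ (hi.comp hk) (hj.comp hk)).tendsto_rpow_mul_norm_sum hp1 hp2
    fun η hη => (hij η hη).imp fun M hM m => hM (k m)

end
end

section
/- (Commutative case of Corollary 1.2.) Let 1 ≤ p < 2 and let (Ω, μ) be a finite measure space. Let X be a Banach space which is the closed linear span of an infinite matrix of its elements (x_{ij})_{i,j∈ℕ} such that, for some λ ≥ 1: (i) every row (x_{ij})_{j∈ℕ} and every column (x_{ij})_{i∈ℕ} is λ-equivalent to the usual ℓ² basis; (ii) every generalized diagonal (x_{i_n,j_n})_{n∈ℕ} (i_1 < i_2 < ⋯, j_1 < j_2 < ⋯) is λ-equivalent to the usual ℓ^p basis. Then X is not Banach isomorphic to a subspace of L^p(μ); that is, there is no bounded linear map T : X → L^p(μ) which is bounded below (i.e., ‖Tx‖ ≥ c‖x‖ for some c > 0 and all x ∈ X). -/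
open MeasureTheory Filter
open scoped ENNReal NNReal BigOperators

noncomputable section

variable {E : Type*} [NormedAddCommGroup E] [NormedSpace ℝ E]

namespace SignAverage

variable {ι : Type*} [Fintype ι]

/-- The signed sum `∑ k, σ k * a k`. -/
def signSum (σ : ι → ℤˣ) (a : ι → ℝ) : ℝ := ∑ k, ((σ k : ℤ) : ℝ) * a k

lemma sign_mul_self (u : ℤˣ) : ((u : ℤ) : ℝ) * ((u : ℤ) : ℝ) = 1 := by
  rcases Int.units_eq_one_or u with rfl | rfl <;> simp

lemma abs_sign (u : ℤˣ) : |((u : ℤ) : ℝ)| = 1 := by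
  rcases Int.units_eq_one_or u with rfl | rfl <;> simp

lemma rpow_half_sum_sq_le {p M : ℝ} (hp0 : 0 < p) (hp : p ≤ 2) (hM : 0 ≤ M) (a : ι → ℝ) :
    (∑ k, a k ^ 2) ^ (p / 2) ≤
      (Fintype.card ι : ℝ) ^ (p / 2) * M ^ p + ∑ k, if M ≤ |a k| then |a k| ^ p else 0 := by
  have hh : 0 ≤ p / 2 := by positivity
  have hh1 : p / 2 ≤ 1 := by linarith
  have hsplit : ∑ k, a k ^ 2 ≤
      Fintype.card ι * M ^ 2 + ∑ k, if M ≤ |a k| then a k ^ 2 else 0 := by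
    rw [← nsmul_eq_mul, ← Finset.card_univ, ← Finset.sum_const, ← Finset.sum_add_distrib]
    refine Finset.sum_le_sum fun k _ => ?_
    split_ifs with h
    · nlinarith
    · rw [add_zero, ← sq_abs]
      exact pow_le_pow_left₀ (abs_nonneg _) (not_le.1 h).le 2
  have hnn : 0 ≤ ∑ k, if M ≤ |a k| then a k ^ 2 else 0 :=
    Finset.sum_nonneg fun k _ => by split_ifs <;> positivity
  refine (Real.rpow_le_rpow (Finset.sum_nonneg fun _ _ => sq_nonneg _) hsplit hh).trans ?_
  refine (Real.rpow_add_le_add_rpow (by positivity) hnn hh hh1).trans (add_le_add ?_ ?_)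
  · rw [Real.mul_rpow (by positivity) (by positivity), ← Real.rpow_two, ← Real.rpow_mul hM,
      mul_div_cancel₀ _ two_ne_zero]
  · refine (Finset.le_sum_of_subadditive_on_pred (fun t : ℝ => t ^ (p / 2)) (fun t => 0 ≤ t)
      (by simp [Real.zero_rpow (show p / 2 ≠ 0 by positivity)])
      (fun x y hx hy => Real.rpow_add_le_add_rpow hx hy hh hh1) (fun _ _ => add_nonneg) _
      fun k _ => by split_ifs <;> positivity).trans (Finset.sum_le_sum fun k _ => ?_)
    split_ifs with h
    · rw [← sq_abs, ← Real.rpow_two, ← Real.rpow_mul (abs_nonneg _),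
        mul_div_cancel₀ _ two_ne_zero]
    · rw [Real.zero_rpow (by positivity)]

variable [DecidableEq ι]

lemma sum_sign_mul_sign {k l : ι} (h : k ≠ l) :
    ∑ σ : ι → ℤˣ, ((σ k : ℤ) : ℝ) * ((σ l : ℤ) : ℝ) = 0 := by
  have key := Equiv.sum_comp (Equiv.mulLeft (Pi.mulSingle k (-1) : ι → ℤˣ))
    fun σ => ((σ k : ℤ) : ℝ) * ((σ l : ℤ) : ℝ)
  simp only [Equiv.coe_mulLeft, Pi.mul_apply, Pi.mulSingle_eq_same,
    Pi.mulSingle_eq_of_ne h.symm] at key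
  simp only [neg_mul, one_mul, Units.val_neg, Int.cast_neg, Finset.sum_neg_distrib] at key
  linarith

/-- Orthogonality of signs. -/
lemma sum_signSum_sq (a : ι → ℝ) :
    ∑ σ : ι → ℤˣ, signSum σ a ^ 2 = Fintype.card (ι → ℤˣ) * ∑ k, a k ^ 2 := by
  have expand (σ : ι → ℤˣ) : signSum σ a ^ 2 =
      ∑ k, ∑ l, a k * a l * (((σ k : ℤ) : ℝ) * ((σ l : ℤ) : ℝ)) := by
    rw [signSum, sq, Finset.sum_mul_sum]
    exact Finset.sum_congr rfl fun k _ => Finset.sum_congr rfl fun l _ => by ring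
  simp_rw [expand]
  rw [Finset.sum_comm, Finset.mul_sum]
  refine Finset.sum_congr rfl fun k _ => ?_
  rw [Finset.sum_comm, Finset.sum_eq_single k]
  · simp [sign_mul_self, sq]
  · intro l _ hl
    rw [← Finset.mul_sum, sum_sign_mul_sign hl.symm, mul_zero]
  · simp

/-- The average of `|∑ ± a k| ^ p` dominates each `|a l| ^ p`. -/
lemma card_mul_le_sum_signSum {p : ℝ} (hp : 1 ≤ p) (a : ι → ℝ) (l : ι) :
    Fintype.card (ι → ℤˣ) * |a l| ^ p ≤ ∑ σ : ι → ℤˣ, |signSum σ a| ^ p := by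
  set τ : ι → ℤˣ := fun k => if k = l then 1 else -1
  have pair (σ : ι → ℤˣ) : signSum σ a + signSum (τ * σ) a = 2 * (((σ l : ℤ) : ℝ) * a l) := by
    rw [signSum, signSum, ← Finset.sum_add_distrib, Finset.sum_eq_single l]
    · simp [τ]; ring
    · intro k _ hk
      simp [τ, hk]
    · simp
  have hb (σ : ι → ℤˣ) :
      2 * |a l| ^ p ≤ |signSum σ a| ^ p + |signSum (τ * σ) a| ^ p := by
    have h1 : 2 * |a l| ≤ |signSum σ a| + |signSum (τ * σ) a| := by
      have := abs_add_le (signSum σ a) (signSum (τ * σ) a)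
      rwa [pair, abs_mul, abs_mul, abs_sign, one_mul, abs_two] at this
    have h2 := (convexOn_rpow hp).2 (abs_nonneg (signSum σ a)) (abs_nonneg (signSum (τ * σ) a))
      (show (0 : ℝ) ≤ 1 / 2 by norm_num) (show (0 : ℝ) ≤ 1 / 2 by norm_num) (by norm_num)
    simp only [smul_eq_mul] at h2
    have h3 : |a l| ^ p ≤ (1 / 2 * |signSum σ a| + 1 / 2 * |signSum (τ * σ) a|) ^ p :=
      Real.rpow_le_rpow (abs_nonneg _) (by linarith) (by linarith)
    linarith
  have hs := Finset.sum_le_sum fun σ (_ : σ ∈ Finset.univ) => hb σ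
  have he := Equiv.sum_comp (Equiv.mulLeft τ) fun σ => |signSum σ a| ^ p
  simp only [Equiv.coe_mulLeft] at he
  rw [Finset.sum_add_distrib, he, Finset.sum_const, Finset.card_univ, nsmul_eq_mul] at hs
  linarith

/-- The average of `|∑ ± a k| ^ p` is at most `(∑ a k ^ 2) ^ (p / 2)` when `p ≤ 2`. -/
lemma sum_signSum_le {p : ℝ} (hp0 : 0 < p) (hp : p ≤ 2) (a : ι → ℝ) :
    ∑ σ : ι → ℤˣ, |signSum σ a| ^ p ≤
      Fintype.card (ι → ℤˣ) * (∑ k, a k ^ 2) ^ (p / 2) := by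
  have hN : (0 : ℝ) < Fintype.card (ι → ℤˣ) := by exact_mod_cast Fintype.card_pos
  have hmean := Real.rpow_arith_mean_le_arith_mean_rpow Finset.univ
    (fun _ : ι → ℤˣ => (Fintype.card (ι → ℤˣ) : ℝ)⁻¹) (fun σ => |signSum σ a| ^ p)
    (fun _ _ => by positivity) (by simp) (fun _ _ => by positivity)
    (p := 2 / p) (by rwa [le_div_iff₀ hp0, one_mul])
  have hpow (σ : ι → ℤˣ) : (|signSum σ a| ^ p) ^ (2 / p) = signSum σ a ^ 2 := by
    rw [← Real.rpow_mul (abs_nonneg _), mul_div_cancel₀ _ hp0.ne', Real.rpow_two, sq_abs]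
  simp only [hpow, ← Finset.mul_sum, sum_signSum_sq, inv_mul_cancel_left₀ hN.ne'] at hmean
  have hnn : 0 ≤ (Fintype.card (ι → ℤˣ) : ℝ)⁻¹ * ∑ σ : ι → ℤˣ, |signSum σ a| ^ p :=
    mul_nonneg (by positivity) (Finset.sum_nonneg fun _ _ => by positivity)
  have := Real.rpow_le_rpow (Real.rpow_nonneg hnn _) hmean (z := p / 2) (by positivity)
  rw [← Real.rpow_mul hnn, div_mul_div_cancel₀ hp0.ne', div_self two_ne_zero, Real.rpow_one,
    inv_mul_le_iff₀ hN] at this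
  exact this

end SignAverage

namespace PowMeasure

open SignAverage

variable {Ω : Type*} [MeasurableSpace Ω] {μ : Measure Ω} {p : ℝ}

/-- The measure `|f| ^ p μ` attached to `f ∈ L^p(μ)`. -/
def powMeasure (f : Lp ℝ (ENNReal.ofReal p) μ) : Measure Ω :=
  μ.withDensity fun x => ENNReal.ofReal (|f x| ^ p)

lemma integrable_abs_rpow (hp : 0 < p) (f : Lp ℝ (ENNReal.ofReal p) μ) :
    Integrable (fun x => |f x| ^ p) μ := by
  simpa [ENNReal.toReal_ofReal hp.le] using
    (Lp.memLp f).integrable_norm_rpow (by simpa using hp) ENNReal.ofReal_ne_top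

lemma norm_rpow_eq_integral (hp : 0 < p) (f : Lp ℝ (ENNReal.ofReal p) μ) :
    ‖f‖ ^ p = ∫ x, |f x| ^ p ∂μ := by
  have hnn : 0 ≤ ∫ x, |f x| ^ p ∂μ := integral_nonneg fun _ => by positivity
  rw [Lp.norm_def, (Lp.memLp f).eLpNorm_eq_integral_rpow_norm (by simpa using hp)
    ENNReal.ofReal_ne_top]
  simp only [ENNReal.toReal_ofReal hp.le, Real.norm_eq_abs]
  rw [ENNReal.toReal_ofReal (by positivity), Real.rpow_inv_rpow hnn hp.ne']

lemma isFiniteMeasure_powMeasure (hp : 0 < p) (f : Lp ℝ (ENNReal.ofReal p) μ) :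
    IsFiniteMeasure (powMeasure f) :=
  isFiniteMeasure_withDensity_ofReal (integrable_abs_rpow hp f).2

lemma powMeasure_real (hp : 0 < p) (f : Lp ℝ (ENNReal.ofReal p) μ) {A : Set Ω}
    (hA : MeasurableSet A) : (powMeasure f).real A = ∫ x in A, |f x| ^ p ∂μ := by
  rw [measureReal_def, powMeasure, withDensity_apply _ hA,
    ← ofReal_integral_eq_lintegral_ofReal (integrable_abs_rpow hp f).integrableOn
      (Eventually.of_forall fun _ => by positivity),
    ENNReal.toReal_ofReal (integral_nonneg fun _ => by positivity)]

lemma eventually_powMeasure_real_le [IsFiniteMeasure μ] (hp : 0 < p)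
    (f : Lp ℝ (ENNReal.ofReal p) μ) {δ : ℝ} (hδ : 0 < δ) :
    ∀ᶠ ε in nhdsWithin (0 : ℝ) (Set.Ioi 0), ∀ A : Set Ω, MeasurableSet A → μ.real A ≤ ε →
      (powMeasure f).real A ≤ δ := by
  have := isFiniteMeasure_powMeasure hp f
  have hfin : ∫⁻ x, ENNReal.ofReal (|f x| ^ p) ∂μ ≠ ⊤ := by
    rw [← setLIntegral_univ, ← withDensity_apply _ MeasurableSet.univ]
    exact measure_ne_top (powMeasure f) _
  obtain ⟨d, hd, h⟩ := exists_pos_setLIntegral_lt_of_measure_lt hfin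
    (ENNReal.ofReal_pos.2 hδ).ne'
  obtain ⟨e, he, hed⟩ := ENNReal.lt_iff_exists_nnreal_btwn.1 hd
  have he0 : (0 : ℝ) < e := by exact_mod_cast he
  filter_upwards [Ioo_mem_nhdsGT he0] with ε hε A hA hAε
  refine ENNReal.toReal_le_of_le_ofReal hδ.le ?_
  rw [powMeasure, withDensity_apply _ hA]
  refine (h A (lt_of_le_of_lt ?_ hed)).le
  rw [← ofReal_measureReal, ENNReal.ofReal_le_iff_le_toReal ENNReal.coe_ne_top]
  exact hAε.trans hε.2.le

variable {ι : Type*} [Fintype ι]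

lemma coeFn_signed_sum (σ : ι → ℤˣ) (f : ι → Lp ℝ (ENNReal.ofReal p) μ) :
    ⇑(∑ k, ((σ k : ℤ) : ℝ) • f k) =ᵐ[μ] fun x => signSum σ fun k => f k x := by
  have h : ∀ᵐ x ∂μ, ∀ k, (((σ k : ℤ) : ℝ) • f k : Lp ℝ (ENNReal.ofReal p) μ) x =
      ((σ k : ℤ) : ℝ) * f k x :=
    ae_all_iff.2 fun k => Lp.coeFn_smul _ _
  filter_upwards [Lp.coeFn_fun_finsetSum Finset.univ fun k => ((σ k : ℤ) : ℝ) • f k, h]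
    with x hx h
  rw [hx]
  exact Finset.sum_congr rfl fun k _ => h k

lemma ae_eq_signSum_rpow (σ : ι → ℤˣ) (f : ι → Lp ℝ (ENNReal.ofReal p) μ) :
    (fun x => |(∑ k, ((σ k : ℤ) : ℝ) • f k : Lp ℝ (ENNReal.ofReal p) μ) x| ^ p) =ᵐ[μ]
      fun x => |signSum σ fun k => f k x| ^ p := by
  filter_upwards [coeFn_signed_sum σ f] with x hx
  rw [hx]

lemma integrable_signSum (hp : 0 < p) (σ : ι → ℤˣ) (f : ι → Lp ℝ (ENNReal.ofReal p) μ) :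
    Integrable (fun x => |signSum σ fun k => f k x| ^ p) μ :=
  (integrable_abs_rpow hp _).congr (ae_eq_signSum_rpow σ f)

lemma norm_signed_sum_rpow (hp : 0 < p) (σ : ι → ℤˣ) (f : ι → Lp ℝ (ENNReal.ofReal p) μ) :
    ‖∑ k, ((σ k : ℤ) : ℝ) • f k‖ ^ p = ∫ x, |signSum σ fun k => f k x| ^ p ∂μ := by
  rw [norm_rpow_eq_integral hp, integral_congr_ae (ae_eq_signSum_rpow σ f)]

variable [DecidableEq ι]

/-- If all signed sums are bounded by `K` in `p`-th power, then the functions carry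
total `p`-mass at most `K` on disjoint sets. -/
lemma sum_powMeasure_disjoint_le (hp : 1 ≤ p) {f : ι → Lp ℝ (ENNReal.ofReal p) μ} {K : ℝ}
    (hK : ∀ σ : ι → ℤˣ, ‖∑ k, ((σ k : ℤ) : ℝ) • f k‖ ^ p ≤ K) {A : ι → Set Ω}
    (hA : ∀ k, MeasurableSet (A k)) (hdisj : Pairwise (Function.onFun Disjoint A)) :
    ∑ k, (powMeasure (f k)).real (A k) ≤ K := by
  have hp0 : 0 < p := by linarith
  set N : ℝ := (Fintype.card (ι → ℤˣ) : ℝ) with hN_def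
  have hN : 0 < N := by rw [hN_def]; exact_mod_cast Fintype.card_pos
  set G : Ω → ℝ := fun x => ∑ σ : ι → ℤˣ, |signSum σ fun k => f k x| ^ p
  have hG : Integrable G μ := integrable_finsetSum _ fun σ _ => integrable_signSum hp0 σ f
  have h1 (k : ι) : N * (powMeasure (f k)).real (A k) ≤ ∫ x in A k, G x ∂μ := by
    rw [powMeasure_real hp0 _ (hA k), ← integral_const_mul]
    exact integral_mono ((integrable_abs_rpow hp0 _).const_mul _).integrableOn hG.integrableOn
      fun x => card_mul_le_sum_signSum hp (fun k => f k x) k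
  have h2 : ∑ k, ∫ x in A k, G x ∂μ ≤ ∫ x, G x ∂μ := by
    rw [← integral_iUnion_fintype hA hdisj fun _ => hG.integrableOn]
    exact setIntegral_le_integral hG
      (Eventually.of_forall fun x => Finset.sum_nonneg fun _ _ => by positivity)
  have h3 : ∫ x, G x ∂μ ≤ N * K := by
    rw [integral_finsetSum _ fun σ _ => integrable_signSum hp0 σ f]
    calc _ ≤ ∑ _σ : ι → ℤˣ, K :=
          Finset.sum_le_sum fun σ _ => (norm_signed_sum_rpow hp0 σ f).symm.trans_le (hK σ)
      _ = N * K := by rw [Finset.sum_const, Finset.card_univ, nsmul_eq_mul]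
  refine le_of_mul_le_mul_left (le_trans ?_ h3) hN
  rw [Finset.mul_sum]
  exact (Finset.sum_le_sum fun k _ => h1 k).trans h2

/-- A version of `sum_powMeasure_disjoint_le` for almost disjoint sets. -/
lemma card_mul_le_of_almost_disjoint (hp : 1 ≤ p) {f : ι → Lp ℝ (ENNReal.ofReal p) μ} {K : ℝ}
    (hK : ∀ σ : ι → ℤˣ, ‖∑ k, ((σ k : ℤ) : ℝ) • f k‖ ^ p ≤ K) {A : ι → Set Ω}
    (hA : ∀ k, MeasurableSet (A k)) {r : ι → ι → Prop} (hr : ∀ k l, k ≠ l → r k l ∨ r l k)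
    {δ η : ℝ} (hη : 0 ≤ η) (hηδ : Fintype.card ι * η ≤ δ / 2)
    (hδ : ∀ k, δ ≤ (powMeasure (f k)).real (A k))
    (hsmall : ∀ k l, r k l → (powMeasure (f k)).real (A l) ≤ η) :
    Fintype.card ι * (δ / 2) ≤ K := by
  classical
  have hp0 : 0 < p := by linarith
  have (k : ι) := isFiniteMeasure_powMeasure hp0 (f k)
  let C : ι → Set Ω := fun k => ⋃ l ∈ Finset.univ.filter (r k), A l
  have hC (k : ι) : MeasurableSet (C k) := Finset.measurableSet_biUnion _ fun l _ => hA l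
  have hsub {k l : ι} (h : r k l) : A l ⊆ C k := fun x hx =>
    Set.mem_biUnion (by simpa using h) hx
  have hdisj : Pairwise (Function.onFun Disjoint fun k => A k \ C k) := by
    intro k l hkl
    rcases hr k l hkl with h | h
    · exact Set.disjoint_left.2 fun x hx hy => hx.2 (hsub h hy.1)
    · exact Set.disjoint_left.2 fun x hx hy => hy.2 (hsub h hx.1)
  have hmass (k : ι) : δ / 2 ≤ (powMeasure (f k)).real (A k \ C k) := by
    have h1 : (powMeasure (f k)).real (C k) ≤ Fintype.card ι * η :=
      calc _ ≤ ∑ l ∈ Finset.univ.filter (r k), (powMeasure (f k)).real (A l) :=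
            measureReal_biUnion_finset_le _ _
        _ ≤ ∑ _l ∈ Finset.univ.filter (r k), η :=
            Finset.sum_le_sum fun l hl => hsmall k l (by simpa using hl)
        _ ≤ ∑ _l : ι, η :=
            Finset.sum_le_sum_of_subset_of_nonneg (Finset.filter_subset _ _) fun _ _ _ => hη
        _ = Fintype.card ι * η := by rw [Finset.sum_const, Finset.card_univ, nsmul_eq_mul]
    have h2 : (powMeasure (f k)).real (A k) ≤
        (powMeasure (f k)).real (A k \ C k) + (powMeasure (f k)).real (C k) :=
      (measureReal_mono (by simp)).trans (measureReal_union_le _ _)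
    linarith [hδ k]
  calc (Fintype.card ι : ℝ) * (δ / 2) = ∑ _k : ι, δ / 2 := by
        rw [Finset.sum_const, Finset.card_univ, nsmul_eq_mul]
    _ ≤ _ := Finset.sum_le_sum fun k _ => hmass k
    _ ≤ K := sum_powMeasure_disjoint_le hp hK (fun k => (hA k).diff (hC k)) hdisj

/-- Lower bounds on signed sums force large tails. -/
lemma le_of_tail_le [IsFiniteMeasure μ] (hp0 : 0 < p) (hp : p ≤ 2)
    {f : ι → Lp ℝ (ENNReal.ofReal p) μ} {L M δ : ℝ} (hM : 0 ≤ M)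
    (hL : ∀ σ : ι → ℤˣ, L ≤ ‖∑ k, ((σ k : ℤ) : ℝ) • f k‖ ^ p)
    (htail : ∀ k, (powMeasure (f k)).real {x | M ≤ |f k x|} ≤ δ) :
    L ≤ (Fintype.card ι : ℝ) ^ (p / 2) * M ^ p * μ.real Set.univ + Fintype.card ι * δ := by
  set N : ℝ := (Fintype.card (ι → ℤˣ) : ℝ) with hN_def
  have hN : 0 < N := by rw [hN_def]; exact_mod_cast Fintype.card_pos
  have hmeas (k : ι) : MeasurableSet {x | M ≤ |f k x|} :=
    measurableSet_le measurable_const (Lp.stronglyMeasurable (f k)).measurable.abs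
  have htint (k : ι) : Integrable (fun x => if M ≤ |f k x| then |f k x| ^ p else 0) μ :=
    (integrable_abs_rpow hp0 (f k)).indicator (hmeas k)
  have hteq (k : ι) : ∫ x, (if M ≤ |f k x| then |f k x| ^ p else 0) ∂μ =
      (powMeasure (f k)).real {x | M ≤ |f k x|} := by
    rw [powMeasure_real hp0 _ (hmeas k), ← integral_indicator (hmeas k)]
    rfl
  have hRint : Integrable (fun x => N * ((Fintype.card ι : ℝ) ^ (p / 2) * M ^ p +
      ∑ k, if M ≤ |f k x| then |f k x| ^ p else 0)) μ :=
    ((integrable_const _).add (integrable_finsetSum _ fun k _ => htint k)).const_mul _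
  have h1 : N * L ≤ ∫ x, ∑ σ : ι → ℤˣ, |signSum σ fun k => f k x| ^ p ∂μ := by
    rw [integral_finsetSum _ fun σ _ => integrable_signSum hp0 σ f]
    calc N * L = ∑ _σ : ι → ℤˣ, L := by
          rw [Finset.sum_const, Finset.card_univ, nsmul_eq_mul]
      _ ≤ _ := Finset.sum_le_sum fun σ _ => (hL σ).trans_eq (norm_signed_sum_rpow hp0 σ f)
  have h2 := integral_mono (integrable_finsetSum _ fun σ _ => integrable_signSum hp0 σ f) hRint
    fun x => (sum_signSum_le hp0 hp fun k => f k x).trans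
      (mul_le_mul_of_nonneg_left (rpow_half_sum_sq_le hp0 hp hM fun k => f k x) hN.le)
  rw [integral_const_mul, integral_add (integrable_const _)
    (integrable_finsetSum _ fun k _ => htint k), integral_finsetSum _ fun k _ => htint k,
    integral_const, smul_eq_mul] at h2
  have h3 : ∑ k, ∫ x, (if M ≤ |f k x| then |f k x| ^ p else 0) ∂μ ≤ Fintype.card ι * δ := by
    rw [← nsmul_eq_mul, ← Finset.card_univ, ← Finset.sum_const]
    exact Finset.sum_le_sum fun k _ => (hteq k).trans_le (htail k)
  have h4 := le_of_mul_le_mul_left (h1.trans h2) hN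
  linarith

end PowMeasure

namespace MatrixInLp

open SignAverage PowMeasure

variable {Ω : Type*} [MeasurableSpace Ω] {μ : Measure Ω} {p : ℝ}

/-- All signed sums of distinct terms of `g` obey an upper `ℓ²` estimate, stated for the
`p`-th power of the norm. -/
def HasUpperTwoEstimate (C : ℝ) (g : ℕ → Lp ℝ (ENNReal.ofReal p) μ) : Prop :=
  ∀ (n : ℕ) (j : Fin n → ℕ), Function.Injective j → ∀ σ : Fin n → ℤˣ,
    ‖∑ k, ((σ k : ℤ) : ℝ) • g (j k)‖ ^ p ≤ C * (n : ℝ) ^ (p / 2)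

lemma exists_mul_rpow_half_lt (hp : p < 2) (C : ℝ) {δ : ℝ} (hδ : 0 < δ) :
    ∃ n : ℕ, 0 < n ∧ C * (n : ℝ) ^ (p / 2) < n * δ := by
  have ht : Tendsto (fun n : ℕ => C * (n : ℝ) ^ (-(1 - p / 2))) atTop (nhds (C * 0)) :=
    ((tendsto_rpow_neg_atTop (by linarith)).comp tendsto_natCast_atTop_atTop).const_mul C
  rw [mul_zero] at ht
  obtain ⟨n, h, hn⟩ := ((ht.eventually_lt_const hδ).and (eventually_gt_atTop 0)).exists
  have hn' : (0 : ℝ) < n := by exact_mod_cast hn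
  refine ⟨n, hn, ?_⟩
  have h2 : (n : ℝ) ^ (p / 2) = n * (n : ℝ) ^ (-(1 - p / 2)) := by
    nth_rw 2 [← Real.rpow_one (n : ℝ)]
    rw [← Real.rpow_add hn']
    ring_nf
  rw [h2]
  nlinarith

/-- An upper `ℓ²` estimate prevents long almost disjoint sequences of fixed mass. -/
lemma HasUpperTwoEstimate.false_of_almost_disjoint (hp : 1 ≤ p) {C : ℝ}
    {g : ℕ → Lp ℝ (ENNReal.ofReal p) μ} (hg : HasUpperTwoEstimate C g) {δ : ℝ} {n : ℕ}
    (hδ : 0 < δ) (hn : 0 < n) (hnC : C * (n : ℝ) ^ (p / 2) < n * (δ / 2)) {j : Fin n → ℕ}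
    {A : Fin n → Set Ω} (hA : ∀ k, MeasurableSet (A k)) {r : Fin n → Fin n → Prop}
    (hr : ∀ k l, k ≠ l → r k l ∨ r l k)
    (hmass : ∀ k, δ < (powMeasure (g (j k))).real (A k))
    (hsmall : ∀ k l, r k l → (powMeasure (g (j k))).real (A l) ≤ δ / (2 * n)) : False := by
  have hn' : (1 : ℝ) ≤ n := by exact_mod_cast hn
  have hlt : δ / (2 * n) < δ := div_lt_self hδ (by linarith)
  have hj : Function.Injective j := by
    intro k l hkl
    by_contra hne
    rcases hr k l hne with h | h
    · have := hsmall k l h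
      rw [hkl] at this
      linarith [hmass l]
    · have := hsmall l k h
      rw [← hkl] at this
      linarith [hmass k]
  have := card_mul_le_of_almost_disjoint hp (hg n j hj) hA hr (δ := δ) (η := δ / (2 * n))
    (by positivity) (by rw [Fintype.card_fin]; exact le_of_eq (by field_simp))
    (fun k => (hmass k).le) hsmall
  rw [Fintype.card_fin] at this
  linarith

/-- An upper `ℓ²` estimate implies uniform integrability of the `p`-th powers. -/
lemma HasUpperTwoEstimate.eventually_powMeasure_le [IsFiniteMeasure μ] (hp : 1 ≤ p) (hp2 : p < 2)
    {C : ℝ} {g : ℕ → Lp ℝ (ENNReal.ofReal p) μ} (hg : HasUpperTwoEstimate C g) {δ : ℝ}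
    (hδ : 0 < δ) :
    ∀ᶠ ε in nhdsWithin (0 : ℝ) (Set.Ioi 0), ∀ j, ∀ A : Set Ω, MeasurableSet A → μ.real A ≤ ε →
      (powMeasure (g j)).real A ≤ δ := by
  by_contra hcon
  obtain ⟨n, hn, hnC⟩ := exists_mul_rpow_half_lt hp2 C (half_pos hδ)
  have hn' : (0 : ℝ) < n := by exact_mod_cast hn
  obtain ⟨s, hs, hrel⟩ := exists_seq_of_forall_finset_exists
    (fun a : ℕ × Set Ω => MeasurableSet a.2 ∧ δ < (powMeasure (g a.1)).real a.2)
    (fun a b => (powMeasure (g a.1)).real b.2 ≤ δ / (2 * n)) (by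
      intro F _
      have hF := (Finset.eventually_all F).2 fun a _ => eventually_powMeasure_real_le
        (by linarith) (g a.1) (δ := δ / (2 * n)) (by positivity)
      obtain ⟨ε, hε, hFε⟩ := ((not_eventually.1 hcon).and_eventually hF).exists
      push Not at hε
      obtain ⟨j, A, hA, hAε, hjA⟩ := hε
      exact ⟨(j, A), ⟨hA, hjA⟩, fun a ha => hFε a ha A hA hAε⟩)
  exact hg.false_of_almost_disjoint hp hδ hn hnC (j := fun k => (s k).1)
    (A := fun k => (s k).2) (fun k => (hs k).1) (r := fun k l => k < l)
    (fun k l h => lt_or_gt_of_ne h) (fun k => (hs k).2) fun k l h => hrel k l h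

variable {f : ℕ → ℕ → Lp ℝ (ENNReal.ofReal p) μ} {C : ℝ}

/-- Along an ultrafilter, the entries of the rows are uniformly absolutely continuous on fixed
sets, uniformly over all rows. -/
lemma exists_forall_eventually_powMeasure_le [IsFiniteMeasure μ] (hp : 1 ≤ p) (hp2 : p < 2)
    (hrow : ∀ i, HasUpperTwoEstimate C (f i)) (hcol : ∀ j, HasUpperTwoEstimate C fun i => f i j)
    (U : Ultrafilter ℕ) {δ : ℝ} (hδ : 0 < δ) :
    ∃ ε > 0, ∀ i, ∀ A : Set Ω, MeasurableSet A → μ.real A ≤ ε →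
      ∀ᶠ j in (U : Filter ℕ), (powMeasure (f i j)).real A ≤ δ := by
  by_contra! hcon
  obtain ⟨n, hn, hnC⟩ := exists_mul_rpow_half_lt hp2 C (half_pos hδ)
  have hn' : (0 : ℝ) < n := by exact_mod_cast hn
  obtain ⟨s, hs, hrel⟩ := exists_seq_of_forall_finset_exists
    (fun a : ℕ × Set Ω => MeasurableSet a.2 ∧
      ∀ᶠ j in (U : Filter ℕ), δ < (powMeasure (f a.1 j)).real a.2)
    (fun a b => ∀ j, (powMeasure (f a.1 j)).real b.2 ≤ δ / (2 * n)) (by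
      intro F _
      have hF := (Finset.eventually_all F).2 fun a _ => (hrow a.1).eventually_powMeasure_le
        hp hp2 (δ := δ / (2 * n)) (by positivity)
      obtain ⟨ε, hFε, hε⟩ := (hF.and self_mem_nhdsWithin).exists
      obtain ⟨i, A, hA, hAε, hiA⟩ := hcon ε hε
      exact ⟨(i, A), ⟨hA, hiA⟩, fun a ha j => hFε a ha j A hA hAε⟩)
  obtain ⟨j, hj⟩ := (eventually_all.2 fun k : Fin n => (hs k).2).exists
  exact (hcol j).false_of_almost_disjoint hp hδ hn hnC (j := fun k => (s k).1)
    (A := fun k => (s k).2) (fun k => (hs k).1) (r := fun k l => k < l)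
    (fun k l h => lt_or_gt_of_ne h) hj fun k l h => hrel k l h j

/-- Every row contains infinitely many entries whose modulus of uniform integrability is small,
uniformly over all rows. -/
lemma exists_forall_frequently_powMeasure_le [IsFiniteMeasure μ] (hp : 1 ≤ p) (hp2 : p < 2)
    (hrow : ∀ i, HasUpperTwoEstimate C (f i)) (hcol : ∀ j, HasUpperTwoEstimate C fun i => f i j)
    {δ : ℝ} (hδ : 0 < δ) :
    ∃ ε > 0, ∀ i, ∃ᶠ j in atTop, ∀ A : Set Ω, MeasurableSet A → μ.real A ≤ ε →
      (powMeasure (f i j)).real A ≤ δ := by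
  obtain ⟨n, hn, hnC⟩ := exists_mul_rpow_half_lt hp2 C (half_pos hδ)
  have hn' : (0 : ℝ) < n := by exact_mod_cast hn
  obtain ⟨ε, hε, hU⟩ := exists_forall_eventually_powMeasure_le hp hp2 hrow hcol
    (hyperfilter ℕ) (δ := δ / (2 * n)) (by positivity)
  refine ⟨ε, hε, fun i => ?_⟩
  by_contra hcon
  have hcon := (not_frequently.1 hcon).filter_mono Nat.hyperfilter_le_atTop
  obtain ⟨s, hs, hrel⟩ := exists_seq_of_forall_finset_exists
    (fun a : ℕ × Set Ω => MeasurableSet a.2 ∧ μ.real a.2 ≤ ε ∧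
      δ < (powMeasure (f i a.1)).real a.2)
    (fun a b => (powMeasure (f i b.1)).real a.2 ≤ δ / (2 * n)) (by
      intro F hF
      obtain ⟨j, hj, hFj⟩ := (hcon.and ((Finset.eventually_all F).2 fun a ha =>
        hU i a.2 (hF a ha).1 (hF a ha).2.1)).exists
      push Not at hj
      obtain ⟨A, hA⟩ := hj
      exact ⟨(j, A), hA, hFj⟩)
  exact (hrow i).false_of_almost_disjoint hp hδ hn hnC (j := fun k => (s k).1)
    (A := fun k => (s k).2) (fun k => (hs k).1) (r := fun k l => l < k)
    (fun k l h => lt_or_gt_of_ne h.symm) (fun k => (hs k).2.2) fun k l h => hrel l k h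

/-- A matrix in `L^p(μ)` whose rows and columns obey upper `ℓ²` estimates has a generalized
diagonal without a lower `ℓ^p` estimate. -/
theorem exists_diagonal_lt [IsFiniteMeasure μ] (hp : 1 ≤ p) (hp2 : p < 2)
    (hrow : ∀ i, HasUpperTwoEstimate C (f i)) (hcol : ∀ j, HasUpperTwoEstimate C fun i => f i j)
    {c : ℝ} (hc : 0 < c) :
    ∃ (j : ℕ → ℕ) (n : ℕ) (σ : Fin n → ℤˣ), StrictMono j ∧
      ‖∑ k : Fin n, ((σ k : ℤ) : ℝ) • f k (j k)‖ ^ p < c * n := by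
  have hp0 : 0 < p := by linarith
  obtain ⟨ε, hε, hfreq⟩ := exists_forall_frequently_powMeasure_le hp hp2 hrow hcol (half_pos hc)
  obtain ⟨j, hj, hjA⟩ := extraction_forall_of_frequently hfreq
  have hC (i k : ℕ) : ∫ x, |f i k x| ^ p ∂μ ≤ C := by
    simpa [norm_rpow_eq_integral hp0] using
      hrow i 1 (fun _ => k) (Function.injective_of_subsingleton _) 1
  obtain ⟨M, hMC, hM0⟩ := (((tendsto_rpow_atTop hp0).eventually_ge_atTop (C / ε)).and
    (eventually_gt_atTop 0)).exists
  have htail (k : ℕ) : μ.real {x | M ≤ |f k (j k) x|} ≤ ε := by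
    have hmarkov := mul_meas_ge_le_integral_of_nonneg (Eventually.of_forall fun x =>
      Real.rpow_nonneg (abs_nonneg (f k (j k) x)) p) (integrable_abs_rpow hp0 (f k (j k))) (M ^ p)
    have hset : {x | M ^ p ≤ |f k (j k) x| ^ p} = {x | M ≤ |f k (j k) x|} := by
      ext x
      exact Real.rpow_le_rpow_iff hM0.le (abs_nonneg _) hp0
    rw [hset] at hmarkov
    have hMp : 0 < M ^ p := by positivity
    rw [div_le_iff₀ hε] at hMC
    exact le_of_mul_le_mul_left ((hmarkov.trans (hC _ _)).trans hMC) hMp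
  obtain ⟨n, -, hnlt⟩ := exists_mul_rpow_half_lt hp2 (M ^ p * μ.real Set.univ) (half_pos hc)
  refine ⟨j, n, ?_⟩
  by_contra! hcon
  have := le_of_tail_le (ι := Fin n) hp0 hp2.le hM0.le (f := fun k => f k (j k))
    (fun σ => hcon σ hj) (δ := c / 2) fun k => hjA k _
      (measurableSet_le measurable_const (Lp.stronglyMeasurable _).measurable.abs) (htail k)
  rw [Fintype.card_fin] at this
  nlinarith

end MatrixInLp

lemma IsLqBasisEquiv.comp_injective {q K : ℝ} {x : ℕ → E} (h : IsLqBasisEquiv q K x) {n : ℕ}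
    {j : Fin n → ℕ} (hj : Function.Injective j) : IsLqBasisEquivFin q K (x ∘ j) := by
  intro a
  have := h (Finset.univ.map ⟨j, hj⟩) (Function.extend j a 0)
  simpa [Finset.sum_map, hj.extend_apply] using this

open SignAverage in
lemma MatrixInLp.hasUpperTwoEstimate_of_isLqBasisEquiv {p : ℝ} (hp : 0 < p)
    {Ω : Type*} [MeasurableSpace Ω] {μ : Measure Ω} [Fact (1 ≤ ENNReal.ofReal p)]
    (T : E →L[ℝ] Lp ℝ (ENNReal.ofReal p) μ) {lam : ℝ} (hlam : 0 ≤ lam) {x : ℕ → E}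
    (hx : IsLqBasisEquiv 2 lam x) :
    HasUpperTwoEstimate ((‖T‖ * lam) ^ p) fun k => T (x k) := by
  intro n j hj σ
  have h1 := (hx.comp_injective hj fun k => ((σ k : ℤ) : ℝ)).2
  simp only [abs_sign, Real.one_rpow, Finset.sum_const, Finset.card_univ, Fintype.card_fin,
    nsmul_eq_mul, mul_one, Function.comp_apply] at h1
  have h2 : ‖∑ k, ((σ k : ℤ) : ℝ) • T (x (j k))‖ ≤ ‖T‖ * lam * (n : ℝ) ^ (1 / 2 : ℝ) := by
    rw [mul_assoc]
    simpa using (T.le_opNorm (∑ k, ((σ k : ℤ) : ℝ) • x (j k))).trans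
      (mul_le_mul_of_nonneg_left h1 (norm_nonneg T))
  refine (Real.rpow_le_rpow (norm_nonneg _) h2 hp.le).trans_eq ?_
  rw [Real.mul_rpow (by positivity) (by positivity), ← Real.rpow_mul (by positivity),
    one_div_mul_eq_div]

/-- (Commutative case of Corollary 1.2.) -/
theorem statement1
    (p : ℝ) (hp1 : 1 ≤ p) (hp2 : p < 2)
    [Fact (1 ≤ ENNReal.ofReal p)]
    {Ω : Type*} [MeasurableSpace Ω] (μ : Measure Ω) [IsFiniteMeasure μ]
    {X : Type*} [NormedAddCommGroup X] [NormedSpace ℝ X] [CompleteSpace X]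
    (x : ℕ → ℕ → X)
    (hspan : (Submodule.span ℝ
      (Set.range fun ij : ℕ × ℕ => x ij.1 ij.2)).topologicalClosure = ⊤)
    (lam : ℝ) (hlam : 1 ≤ lam)
    (hrow : ∀ i, IsLqBasisEquiv 2 lam fun j => x i j)
    (hcol : ∀ j, IsLqBasisEquiv 2 lam fun i => x i j)
    (hdiag : ∀ i j : ℕ → ℕ, StrictMono i → StrictMono j →
      IsLqBasisEquiv p lam fun k => x (i k) (j k)) :
    ¬ ∃ (T : X →L[ℝ] Lp ℝ (ENNReal.ofReal p) μ) (c : ℝ),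
      0 < c ∧ ∀ v : X, c * ‖v‖ ≤ ‖T v‖ := by
  rintro ⟨T, c, hc, hT⟩
  have hp0 : 0 < p := by linarith
  have hlam0 : 0 < lam := by linarith
  obtain ⟨j, n, σ, hj, hlt⟩ := MatrixInLp.exists_diagonal_lt (f := fun i j => T (x i j)) hp1 hp2
    (fun i => MatrixInLp.hasUpperTwoEstimate_of_isLqBasisEquiv hp0 T hlam0.le (hrow i))
    (fun j => MatrixInLp.hasUpperTwoEstimate_of_isLqBasisEquiv hp0 T hlam0.le (hcol j))
    (c := (c * (1 / lam)) ^ p) (by positivity)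
  have h1 := ((hdiag id j strictMono_id hj).comp_injective Fin.val_injective
    fun k : Fin n => ((σ k : ℤ) : ℝ)).1
  simp only [SignAverage.abs_sign, Real.one_rpow, Finset.sum_const, Finset.card_univ,
    Fintype.card_fin, nsmul_eq_mul, mul_one, Function.comp_apply, id] at h1
  have h2 : c * (1 / lam) * (n : ℝ) ^ (1 / p) ≤
      ‖∑ k : Fin n, ((σ k : ℤ) : ℝ) • T (x k (j k))‖ := by
    rw [mul_assoc]
    simpa using (mul_le_mul_of_nonneg_left h1 hc.le).trans
      (hT (∑ k : Fin n, ((σ k : ℤ) : ℝ) • x k (j k)))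
  have h3 := Real.rpow_le_rpow (by positivity) h2 hp0.le
  rw [Real.mul_rpow (by positivity) (by positivity), ← Real.rpow_mul (by positivity),
    one_div_mul_cancel hp0.ne', Real.rpow_one] at h3
  linarith

end
end

section
/- (Equivalent form of Corollary 1.4: L^p contains no λ-GC_p^n spaces uniformly.) For every 1 ≤ p < 2 and every λ ≥ 1 there exists n ∈ ℕ such that there is NO n×n matrix (x_{ij})_{1≤i,j≤n} of elements of L^p([0,1], Lebesgue measure) satisfying: (i) for each i the row (x_{ij})_{j=1}^n, and for each j the column (x_{ij})_{i=1}^n, is λ-equivalent to the usual ℓ²_n basis; (ii) for every m and all indices 1 ≤ i_1 < ⋯ < i_m ≤ n and 1 ≤ j_1 < ⋯ < j_m ≤ n, the sequence (x_{i_k,j_k})_{k=1}^m is λ-equivalent to the usual ℓ^p_m basis. -/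
open MeasureTheory Filter
open scoped ENNReal NNReal BigOperators

noncomputable section

variable {E : Type*} [NormedAddCommGroup E] [NormedSpace ℝ E]

/-- The sign attached to a Boolean. -/
def boolSign (b : Bool) : ℝ := if b then 1 else -1

lemma abs_boolSign (b : Bool) : |boolSign b| = 1 := by
  cases b <;> simp [boolSign]

lemma sum_pi_bool_succ {m : ℕ} (a : Fin (m + 1) → ℝ) (F : ℝ → ℝ) :
    ∑ e : Fin (m + 1) → Bool, F (∑ k, boolSign (e k) * a k) =
      ∑ e : Fin m → Bool, (F (a 0 + ∑ k, boolSign (e k) * a k.succ) +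
        F (-a 0 + ∑ k, boolSign (e k) * a k.succ)) := by
  rw [← (Fin.consEquiv fun _ : Fin (m + 1) => Bool).sum_comp, Fintype.sum_prod_type,
    Fintype.sum_bool, ← Finset.sum_add_distrib]
  simp [Fin.sum_univ_succ, Fin.consEquiv, boolSign]

lemma sum_sign_sq {m : ℕ} (a : Fin m → ℝ) :
    ∑ e : Fin m → Bool, (∑ k, boolSign (e k) * a k) ^ 2 = 2 ^ m * ∑ k, a k ^ 2 := by
  induction m with
  | zero => simp
  | succ m ih =>
    rw [sum_pi_bool_succ a (fun t => t ^ 2)]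
    have : ∀ t : ℝ, (a 0 + t) ^ 2 + (-a 0 + t) ^ 2 = 2 * a 0 ^ 2 + 2 * t ^ 2 := fun t => by ring
    simp only [this, Finset.sum_add_distrib, ← Finset.mul_sum, ih, Fin.sum_univ_succ]
    simp
    ring

lemma sum_sign_fourth_le {m : ℕ} (a : Fin m → ℝ) :
    ∑ e : Fin m → Bool, (∑ k, boolSign (e k) * a k) ^ 4 ≤ 2 ^ m * (3 * (∑ k, a k ^ 2) ^ 2) := by
  induction m with
  | zero => simp
  | succ m ih =>
    rw [sum_pi_bool_succ a (fun t => t ^ 4)]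
    have : ∀ t : ℝ, (a 0 + t) ^ 4 + (-a 0 + t) ^ 4 =
        2 * a 0 ^ 4 + 12 * a 0 ^ 2 * t ^ 2 + 2 * t ^ 4 := fun t => by ring
    simp only [this, Finset.sum_add_distrib, ← Finset.mul_sum, Fin.sum_univ_succ, sum_sign_sq]
    have h := ih fun k => a k.succ
    have h4 : 0 ≤ (2 : ℝ) ^ m * a 0 ^ 4 := by positivity
    simp only [Finset.sum_const, Finset.card_univ, Fintype.card_pi, Fintype.card_bool,
      Finset.prod_const, Fintype.card_fin, nsmul_eq_mul, Nat.cast_pow, Nat.cast_ofNat]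
    rw [pow_succ (2 : ℝ)]
    nlinarith

lemma abs_rpow_le_one_add_sq {p : ℝ} (hp0 : 0 ≤ p) (hp : p ≤ 2) (t : ℝ) :
    |t| ^ p ≤ 1 + t ^ 2 := by
  rcases le_total |t| 1 with h | h
  · have := Real.rpow_le_one (abs_nonneg t) h hp0
    nlinarith [sq_nonneg t]
  · have := Real.rpow_le_rpow_of_exponent_le h hp
    rw [Real.rpow_two, sq_abs] at this
    linarith

lemma sq_sub_fourth_le_abs_rpow {p : ℝ} (hp0 : 0 < p) (hp : p ≤ 2) (t : ℝ) :
    t ^ 2 - t ^ 4 ≤ |t| ^ p := by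
  rcases le_total |t| 1 with h | h
  · rcases eq_or_ne t 0 with rfl | ht
    · simp [Real.zero_rpow hp0.ne']
    have := Real.rpow_le_rpow_of_exponent_ge (abs_pos.2 ht) h hp
    rw [Real.rpow_two, sq_abs] at this
    nlinarith [sq_nonneg (t ^ 2)]
  · have h0 : 0 ≤ |t| ^ p := by positivity
    have h1 : 1 ≤ t ^ 2 := by rw [← sq_abs]; nlinarith
    nlinarith

lemma sum_sign_rpow_le {m : ℕ} (a : Fin m → ℝ) {p : ℝ} (hp0 : 0 < p) (hp : p ≤ 2) :
    ∑ e : Fin m → Bool, |∑ k, boolSign (e k) * a k| ^ p ≤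
      2 ^ m * (2 * (∑ k, a k ^ 2) ^ (p / 2)) := by
  rcases (Finset.sum_nonneg fun k _ => sq_nonneg (a k) : 0 ≤ ∑ k, a k ^ 2).eq_or_lt with h | h
  · have ha : ∀ k, a k = 0 := fun k => by
      simpa using (Finset.sum_eq_zero_iff_of_nonneg fun k _ => sq_nonneg (a k)).1 h.symm k
    simp [ha, Real.zero_rpow hp0.ne', Real.zero_rpow (half_pos hp0).ne']
  set v := ∑ k, a k ^ 2 with hv
  have hs : 0 < √v := Real.sqrt_pos.2 h
  have hs2 : √v ^ 2 = v := Real.sq_sqrt h.le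
  have hsp : √v ^ p = v ^ (p / 2) := by
    rw [Real.sqrt_eq_rpow, ← Real.rpow_mul h.le]; congr 1; ring
  calc _ ≤ ∑ e : Fin m → Bool, √v ^ p * (1 + (∑ k, boolSign (e k) * a k) ^ 2 / v) := by
        refine Finset.sum_le_sum fun e _ => ?_
        set X := ∑ k, boolSign (e k) * a k
        have := abs_rpow_le_one_add_sq hp0.le hp (X / √v)
        rw [abs_div, abs_of_pos hs, Real.div_rpow (abs_nonneg _) hs.le, div_pow, hs2,
          div_le_iff₀ (by positivity)] at this
        linarith
    _ = _ := by
        rw [← Finset.mul_sum, Finset.sum_add_distrib, ← Finset.sum_div, sum_sign_sq, ← hv, hsp]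
        simp only [Finset.sum_const, Finset.card_univ, Fintype.card_pi, Fintype.card_bool,
          Finset.prod_const, Fintype.card_fin, nsmul_eq_mul, Nat.cast_pow, Nat.cast_ofNat]
        field_simp
        ring

lemma le_sum_sign_rpow {m : ℕ} (a : Fin m → ℝ) {p : ℝ} (hp0 : 0 < p) (hp : p ≤ 2) :
    2 ^ m * ((∑ k, a k ^ 2) ^ (p / 2)) ≤
      16 * ∑ e : Fin m → Bool, |∑ k, boolSign (e k) * a k| ^ p := by
  rcases (Finset.sum_nonneg fun k _ => sq_nonneg (a k) : 0 ≤ ∑ k, a k ^ 2).eq_or_lt with h | h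
  · rw [← h, Real.zero_rpow (half_pos hp0).ne', mul_zero]
    exact mul_nonneg (by norm_num) (Finset.sum_nonneg fun _ _ => by positivity)
  set v := ∑ k, a k ^ 2 with hv
  have hs : 0 < √v := Real.sqrt_pos.2 h
  have hs2 : √v ^ 2 = v := Real.sq_sqrt h.le
  have hs4 : √v ^ 4 = v ^ 2 := by
    nth_rw 2 [← hs2]
    ring
  have hsp : √v ^ p = v ^ (p / 2) := by
    rw [Real.sqrt_eq_rpow, ← Real.rpow_mul h.le]; congr 1; ring
  have h2p : (1 : ℝ) ≤ 2 ^ p := Real.one_le_rpow (by norm_num) hp0.le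
  have h4 := sum_sign_fourth_le a
  rw [← hv] at h4
  calc _ = √v ^ p * (4 * (2 ^ m * v) / v - 2 ^ m * (3 * v ^ 2) / v ^ 2) := by
        rw [hsp]; field_simp; ring
    _ ≤ √v ^ p * (4 * (2 ^ m * v) / v -
          (∑ e : Fin m → Bool, (∑ k, boolSign (e k) * a k) ^ 4) / v ^ 2) := by
        gcongr
    _ = ∑ e : Fin m → Bool, √v ^ p * (4 * (∑ k, boolSign (e k) * a k) ^ 2 / v -
          (∑ k, boolSign (e k) * a k) ^ 4 / v ^ 2) := by
        rw [← Finset.mul_sum, Finset.sum_sub_distrib, ← Finset.sum_div, ← Finset.sum_div,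
          ← Finset.mul_sum, sum_sign_sq]
    _ ≤ ∑ e : Fin m → Bool, 16 * |∑ k, boolSign (e k) * a k| ^ p := by
        refine Finset.sum_le_sum fun e _ => ?_
        set X := ∑ k, boolSign (e k) * a k
        have := sq_sub_fourth_le_abs_rpow hp0 hp (X / (2 * √v))
        rw [abs_div, abs_of_pos (by positivity : 0 < 2 * √v),
          Real.div_rpow (abs_nonneg _) (by positivity), div_pow, div_pow, mul_pow, mul_pow, hs2,
          hs4, Real.mul_rpow (by norm_num) hs.le, le_div_iff₀ (by positivity)] at this
        have e1 : (X ^ 2 / (2 ^ 2 * v) - X ^ 4 / (2 ^ 4 * v ^ 2)) * (2 ^ p * √v ^ p) =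
          (2 ^ p * (√v ^ p * (4 * X ^ 2 / v - X ^ 4 / v ^ 2))) / 16 := by
          field_simp; ring
        rw [e1] at this
        have h0 : 0 ≤ |X| ^ p := by positivity
        by_contra hc
        push Not at hc
        nlinarith
    _ = _ := by rw [Finset.mul_sum]

lemma card_le_of_diagonals {n N : ℕ} (B : Finset (Fin n × Fin n))
    (hB : ∀ (m : ℕ) (i j : Fin m → Fin n), StrictMono i → StrictMono j →
      (∀ k, (i k, j k) ∈ B) → m ≤ N) : B.card ≤ N * (2 * n) := by
  by_contra! hc
  obtain ⟨d, -, hd⟩ := Finset.exists_lt_card_fiber_of_mul_lt_card_of_maps_to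
    (s := B) (t := Finset.range (2 * n)) (n := N)
    (f := fun z => (z.1 : ℕ) + (n - z.2)) (by
      intro z _
      have := z.1.2
      have := z.2.2
      simp only [Finset.mem_range]
      omega) (by simpa [mul_comm] using hc)
  set D := B.filter fun z => (z.1 : ℕ) + (n - z.2) = d with hD
  have hinj : Set.InjOn Prod.fst (D : Set (Fin n × Fin n)) := by
    intro z hz w hw h
    have h1 := (Finset.mem_filter.1 hz).2
    have h2 := (Finset.mem_filter.1 hw).2
    have := z.2.2
    have := w.2.2
    refine Prod.ext h (Fin.ext ?_)
    rw [h] at h1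
    omega
  have hcard : (D.image Prod.fst).card = D.card := Finset.card_image_of_injOn hinj
  set i := (D.image Prod.fst).orderEmbOfFin hcard with hi
  have hmem : ∀ k, ∃ j, (i k, j) ∈ D := fun k => by
    have := (D.image Prod.fst).orderEmbOfFin_mem hcard k
    obtain ⟨z, hz, h⟩ := Finset.mem_image.1 this
    exact ⟨z.2, by rw [hi, ← h]; exact hz⟩
  choose j hj using hmem
  refine absurd (hB D.card i j i.strictMono ?_ fun k => (Finset.mem_filter.1 (hj k)).1) (by omega)
  intro k l hkl
  have h1 := (Finset.mem_filter.1 (hj k)).2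
  have h2 := (Finset.mem_filter.1 (hj l)).2
  have h3 : i k < i l := i.strictMono hkl
  have := (j k).2
  have := (j l).2
  simp only [Fin.lt_def] at h3 ⊢
  simp only at h1 h2
  omega

/-- Every entry of the list is related to `i`, relative to the entries that come after it. -/
def IsGoodList {α β : Type*} (P : List β → α → β → Prop) (i : α) : List β → Prop
  | [] => True
  | j :: J => P J i j ∧ IsGoodList P i J

lemma exists_isGoodList {n K B : ℕ} (hn : 0 < n) (hnB : B * 4 ^ (K + 2) ≤ n)
    (P : List (Fin n) → Fin n → Fin n → Prop) (G : Finset (Fin n × Fin n))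
    (hG : 3 * n ^ 2 ≤ 4 * G.card)
    (hP : ∀ J : List (Fin n), J.length ≤ K →
      ∃ S : Finset (Fin n × Fin n), S.card ≤ B * n ∧ ∀ z ∈ G, z ∉ S → P J z.1 z.2) :
    ∃ (i : Fin n) (J : List (Fin n)), J.length = K ∧ IsGoodList P i J := by
  classical
  set I₀ : Finset (Fin n) :=
    Finset.univ.filter fun i => n ≤ 2 * (Finset.univ.filter fun j => (i, j) ∈ G).card with hI₀
  have hGsum : ∀ I : Finset (Fin n), ∀ S : Finset (Fin n × Fin n),
      ∑ i ∈ I, (Finset.univ.filter fun j => (i, j) ∈ S).card ≤ S.card := by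
    intro I S
    rw [← Finset.card_sigma]
    refine Finset.card_le_card_of_injOn (fun z => (z.1, z.2)) ?_ ?_
    · intro z hz
      simpa using (Finset.mem_filter.1 (Finset.mem_sigma.1 hz).2).2
    · rintro ⟨a, b⟩ _ ⟨c, d⟩ _ h
      simp only [Prod.mk.injEq] at h
      obtain ⟨rfl, rfl⟩ := h
      rfl
  have hI₀card : n ≤ 4 * I₀.card := by
    have h1 : G.card = ∑ i, (Finset.univ.filter fun j => (i, j) ∈ G).card := by
      rw [← Finset.card_sigma]
      refine (Finset.card_bij (fun z _ => (z.1, z.2)) ?_ ?_ ?_).symm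
      · intro z hz
        simpa using hz
      · rintro ⟨a, b⟩ _ ⟨c, d⟩ _ h
        simp only [Prod.mk.injEq] at h
        obtain ⟨rfl, rfl⟩ := h
        rfl
      · intro z hz
        exact ⟨⟨z.1, z.2⟩, by simpa using hz, rfl⟩
    have h2 : ∀ i, 2 * (Finset.univ.filter fun j => (i, j) ∈ G).card ≤
        n + if i ∈ I₀ then n else 0 := by
      intro i
      split_ifs with h
      · have := Finset.card_le_univ (Finset.univ.filter fun j => (i, j) ∈ G)
        simp only [Fintype.card_fin] at this
        omega
      · simp only [hI₀, Finset.mem_filter, Finset.mem_univ, true_and, not_le] at h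
        omega
    have h3 := Finset.sum_le_sum fun i (_ : i ∈ Finset.univ) => h2 i
    rw [← Finset.mul_sum, ← h1, Finset.sum_add_distrib, Finset.sum_ite_mem] at h3
    simp only [Finset.sum_const, Finset.card_univ, Fintype.card_fin, smul_eq_mul,
      Finset.univ_inter] at h3
    have : n * n ≤ n * (2 * I₀.card) * 2 := by nlinarith
    nlinarith
  have key : ∀ k ≤ K, ∃ (J : List (Fin n)) (I : Finset (Fin n)), J.length = k ∧ I ⊆ I₀ ∧
      n ≤ 4 ^ (k + 1) * I.card ∧ ∀ i ∈ I, IsGoodList P i J := by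
    intro k
    induction k with
    | zero => exact fun _ => ⟨[], I₀, rfl, subset_rfl, by simpa using hI₀card,
        fun _ _ => trivial⟩
    | succ k ih =>
      intro hk
      obtain ⟨J, I, hJ, hI, hIc, hgood⟩ := ih (by omega)
      obtain ⟨S, hS, hSP⟩ := hP J (by omega)
      have hBI : 4 * B ≤ I.card := by
        have h1 : 4 ^ (k + 2) * (4 * B) ≤ 4 ^ (k + 2) * I.card * 1 := by
          calc 4 ^ (k + 2) * (4 * B) = 4 * (B * 4 ^ (k + 2)) := by ring
            _ ≤ 4 * (B * 4 ^ (K + 1)) := by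
              have : 4 ^ (k + 2) ≤ 4 ^ (K + 1) := Nat.pow_le_pow_right (by norm_num) (by omega)
              gcongr
            _ = B * 4 ^ (K + 2) := by ring
            _ ≤ n := hnB
            _ ≤ 4 ^ (k + 1) * I.card := hIc
            _ ≤ 4 ^ (k + 2) * I.card * 1 := by
              rw [mul_one]
              gcongr
              · norm_num
              · omega
        rw [mul_one] at h1
        exact Nat.le_of_mul_le_mul_left h1 (by positivity)
      set Q : Fin n → Finset (Fin n) :=
        fun j => I.filter fun i => (i, j) ∈ G ∧ (i, j) ∉ S with hQ
      have hdeg : I.card * n ≤ 2 * ∑ j, (Q j).card + 2 * (B * n) := by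
        have h1 : ∑ j, (Q j).card =
            ∑ i ∈ I, (Finset.univ.filter fun j => (i, j) ∈ G ∧ (i, j) ∉ S).card := by
          simp only [hQ, Finset.card_filter]
          exact Finset.sum_comm
        have h2 : ∀ i ∈ I, n ≤ 2 * (Finset.univ.filter fun j => (i, j) ∈ G ∧ (i, j) ∉ S).card +
            2 * (Finset.univ.filter fun j => (i, j) ∈ S).card := by
          intro i hi
          have h3 := (Finset.mem_filter.1 (hI hi)).2
          have h4 : (Finset.univ.filter fun j => (i, j) ∈ G).card ≤
              (Finset.univ.filter fun j => (i, j) ∈ G ∧ (i, j) ∉ S).card +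
                (Finset.univ.filter fun j => (i, j) ∈ S).card := by
            refine (Finset.card_le_card ?_).trans (Finset.card_union_le _ _)
            intro j hj
            simp only [Finset.mem_union, Finset.mem_filter, Finset.mem_univ, true_and] at hj ⊢
            tauto
          omega
        have h5 := Finset.sum_le_sum h2
        rw [Finset.sum_add_distrib, ← Finset.mul_sum, ← Finset.mul_sum, ← h1] at h5
        have h6 := hGsum I S
        simp only [Finset.sum_const, smul_eq_mul] at h5
        omega
      obtain ⟨j, hj⟩ : ∃ j, I.card ≤ 4 * (Q j).card := by
        by_contra! hc
        have h1 : ∑ j, (4 * (Q j).card + 1) ≤ ∑ j : Fin n, I.card :=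
          Finset.sum_le_sum fun j _ => hc j
        rw [Finset.sum_add_distrib, ← Finset.mul_sum] at h1
        simp only [Finset.sum_const, Finset.card_univ, Fintype.card_fin, smul_eq_mul,
          mul_one] at h1
        nlinarith
      refine ⟨j :: J, Q j, by simp [hJ], (Finset.filter_subset _ _).trans hI, ?_, ?_⟩
      · calc n ≤ 4 ^ (k + 1) * I.card := hIc
          _ ≤ 4 ^ (k + 1) * (4 * (Q j).card) := by gcongr
          _ = _ := by ring
      · intro i hi
        obtain ⟨h1, h2, h3⟩ := Finset.mem_filter.1 hi
        exact ⟨hSP _ h2 h3, hgood i h1⟩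
  obtain ⟨J, I, hJ, -, hIc, hgood⟩ := key K le_rfl
  have : I.Nonempty := by
    rw [← Finset.card_pos]
    by_contra! h
    rw [Nat.le_zero.1 h] at hIc
    omega
  obtain ⟨i, hi⟩ := this
  exact ⟨i, J, hJ, hgood i hi⟩

lemma ENNReal.rpow_anti_of_nonpos {z : ℝ} (hz : z ≤ 0) {x y : ℝ≥0∞} (h : x ≤ y) :
    y ^ z ≤ x ^ z := by
  rw [← neg_neg z, ENNReal.rpow_neg x, ENNReal.rpow_neg y]
  exact ENNReal.inv_le_inv.2 (ENNReal.rpow_le_rpow h (by linarith))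

lemma ENNReal.rpow_le_mul_rpow_sub_one_add {q : ℝ} (hq0 : 0 < q) (hq1 : q < 1) {g : ℝ≥0∞}
    (hg : g ≠ ⊤) (Z : ℝ≥0∞) : g ^ q ≤ g * Z ^ (q - 1) + Z ^ q := by
  rcases le_or_gt g Z with h | h
  · exact le_add_left (ENNReal.rpow_le_rpow h hq0.le)
  · refine le_add_right ?_
    have h0 : g ≠ 0 := (zero_le.trans_lt h).ne'
    calc g ^ q = g ^ (1 + (q - 1)) := by congr 1; ring
      _ = g * g ^ (q - 1) := by rw [ENNReal.rpow_add _ _ h0 hg, ENNReal.rpow_one]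
      _ ≤ g * Z ^ (q - 1) := by
        exact mul_le_mul' le_rfl (ENNReal.rpow_anti_of_nonpos (by linarith) h.le)

lemma ENNReal.mul_rpow_sub_one_le {q : ℝ} (hq0 : 0 < q) (x : ℝ≥0∞) :
    x * x ^ (q - 1) ≤ x ^ q := by
  rcases eq_or_ne x 0 with rfl | h0
  · simp
  rcases eq_or_ne x ⊤ with rfl | h1
  · simp [ENNReal.top_rpow_of_pos hq0]
  · nth_rw 1 [← ENNReal.rpow_one x]
    rw [← ENNReal.rpow_add _ _ h0 h1]
    simp

lemma ENNReal.exists_rpow_neg_mul_le {s : ℝ} (hs : 0 < s) {A e : ℝ≥0∞} (hA : A ≠ ⊤)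
    (he : e ≠ 0) : ∃ R : ℝ≥0∞, R ≠ 0 ∧ R ≠ ⊤ ∧ R ^ (-s) * A ≤ e := by
  have hne : min e 1 ≠ 0 := by simp [he]
  have hnt : min e 1 ≠ ⊤ := by simp
  have h0 : A / min e 1 + 1 ≠ 0 := by simp
  have h1 : A / min e 1 + 1 ≠ ⊤ := by simp [ENNReal.div_eq_top, hA, hne]
  refine ⟨(A / min e 1 + 1) ^ (1 / s), ?_, ?_, ?_⟩
  · exact (ENNReal.rpow_pos (pos_iff_ne_zero.2 h0) h1).ne'
  · exact ENNReal.rpow_ne_top_of_nonneg (by positivity) h1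
  · rw [← ENNReal.rpow_mul, show 1 / s * -s = -1 by field_simp, ENNReal.rpow_neg_one,
      mul_comm, ← div_eq_mul_inv]
    refine ENNReal.div_le_of_le_mul' ?_
    calc A = A / min e 1 * min e 1 := (ENNReal.div_mul_cancel hne hnt).symm
      _ ≤ (A / min e 1 + 1) * e := by gcongr <;> simp

lemma ENNReal.mul_rpow_of_ne {x : ℝ≥0∞} (h0 : x ≠ 0) (h1 : x ≠ ⊤) (y : ℝ≥0∞) (z : ℝ) :
    (x * y) ^ z = x ^ z * y ^ z := by
  rw [ENNReal.mul_rpow_eq_ite]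
  simp [h0, h1]

lemma ENNReal.sum_rpow_le {ι : Type*} {q : ℝ} (hq0 : 0 < q) (hq1 : q ≤ 1) (s : Finset ι)
    (x : ι → ℝ≥0∞) : (∑ k ∈ s, x k) ^ q ≤ ∑ k ∈ s, x k ^ q := by
  classical
  induction s using Finset.induction_on with
  | empty => simp [hq0]
  | insert k s hk ih =>
    rw [Finset.sum_insert hk, Finset.sum_insert hk]
    exact (ENNReal.rpow_add_le_add_rpow _ _ hq0.le hq1).trans (by gcongr)

/-- Sum of the values `w j ^ q` over those entries `j` of the list for which `w j` exceeds `M`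
times the sum of the values of `ψ` at the entries that come after `j`. -/
def dominantSum {β : Type*} (q : ℝ) (M : ℝ≥0∞) (w ψ : β → ℝ≥0∞) : List β → ℝ≥0∞
  | [] => 0
  | j :: J => (if M * (J.map ψ).sum < w j then w j ^ q else 0) + dominantSum q M w ψ J

lemma dominantSum_le_length {β : Type*} {q : ℝ} (hq : 0 < q) (M : ℝ≥0∞) {w ψ : β → ℝ≥0∞}
    (hw : ∀ j, w j ≤ ψ j) (J : List β) :
    dominantSum q M w ψ J ≤ J.length * (J.map ψ).sum ^ q := by
  induction J with
  | nil => simp [dominantSum]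
  | cons j J ih =>
    simp only [dominantSum, List.length_cons, List.map_cons, List.sum_cons, Nat.cast_add,
      Nat.cast_one, add_mul, one_mul]
    rw [add_comm]
    gcongr
    · exact ih.trans (by gcongr; exact le_add_self)
    · split_ifs
      · gcongr
        exact (hw j).trans le_self_add
      · exact zero_le

lemma dominantSum_le {β : Type*} {q : ℝ} (hq : 0 < q) {M : ℝ≥0∞} (hM0 : M ≠ 0) (hM1 : M ≠ ⊤)
    {w ψ : β → ℝ≥0∞} {x : ℝ≥0∞} (hw : ∀ j, w j ≤ ψ j) (hwx : ∀ j, w j ≤ x) (J : List β) :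
    dominantSum q M w ψ J ≤ x ^ q + J.length * (M ^ (-q) * x ^ q) := by
  induction J with
  | nil => simp [dominantSum]
  | cons j J ih =>
    simp only [dominantSum]
    split_ifs with h
    · gcongr
      · exact hwx j
      · refine (dominantSum_le_length hq M hw J).trans ?_
        have h1 : (J.map ψ).sum ≤ M⁻¹ * x := by
          rw [mul_comm, ← div_eq_mul_inv, ENNReal.le_div_iff_mul_le (.inl hM0) (.inl hM1),
            mul_comm]
          exact h.le.trans (hwx j)
        have h2 : (J.map ψ).sum ^ q ≤ M ^ (-q) * x ^ q := by
          rw [ENNReal.rpow_neg, ← ENNReal.inv_rpow, ← ENNReal.mul_rpow_of_nonneg _ _ hq.le]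
          gcongr
        gcongr
        simp
    · rw [zero_add]
      refine ih.trans ?_
      gcongr
      simp

lemma measurable_dominantSum {Ω β : Type*} [MeasurableSpace Ω] (q : ℝ) (M : ℝ≥0∞)
    {w ψ : β → Ω → ℝ≥0∞} (hw : ∀ j, Measurable (w j)) (hψ : ∀ j, Measurable (ψ j)) (J : List β) :
    Measurable (fun t => (J.map (ψ · t)).sum) ∧
      Measurable fun t => dominantSum q M (w · t) (ψ · t) J := by
  induction J with
  | nil => simp [dominantSum]
  | cons j J ih =>
    obtain ⟨h1, h2⟩ := ih
    refine ⟨?_, ?_⟩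
    · simp only [List.map_cons, List.sum_cons]
      exact (hψ j).add h1
    · simp only [dominantSum]
      exact (Measurable.ite (measurableSet_lt (h1.const_mul M) (hw j))
        ((hw j).pow_const q) measurable_const).add h2

lemma sum_rpow_le_dominant_add {ι : Type*} {q : ℝ} (hq0 : 0 < q) (hq1 : q < 1)
    {R : ℝ≥0∞} (hR0 : R ≠ 0) (hR1 : R ≠ ⊤) (H : ℝ≥0∞) (s : Finset ι) (g w : ι → ℝ≥0∞)
    (hg : ∀ k, g k ≠ ⊤) :
    (∑ k ∈ s, g k) ^ q ≤ ∑ k ∈ s, (if H < w k then g k ^ q else 0) +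
      R ^ (q - 1) * ∑ k ∈ s, g k * w k ^ (q - 1) + (R * H) ^ q := by
  have h1 : ∑ k ∈ s, g k =
      ∑ k ∈ s, (if H < w k then g k else 0) + ∑ k ∈ s, (if H < w k then 0 else g k) := by
    rw [← Finset.sum_add_distrib]
    refine Finset.sum_congr rfl fun k _ => ?_
    split_ifs <;> simp
  rw [h1, add_assoc]
  refine (ENNReal.rpow_add_le_add_rpow _ _ hq0.le hq1.le).trans ?_
  gcongr ?_ + ?_
  · refine (ENNReal.sum_rpow_le hq0 hq1.le _ _).trans (Finset.sum_le_sum fun k _ => ?_)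
    split_ifs <;> simp [hq0]
  · refine (ENNReal.rpow_le_mul_rpow_sub_one_add hq0 hq1 ?_ (R * H)).trans ?_
    · refine (ENNReal.sum_lt_top.2 fun k _ => ?_).ne
      split_ifs
      · simp
      · exact (hg k).lt_top
    · gcongr ?_ + _
      rw [Finset.sum_mul, Finset.mul_sum]
      refine Finset.sum_le_sum fun k _ => ?_
      split_ifs with h
      · simp
      · rw [ENNReal.mul_rpow_of_ne hR0 hR1, mul_left_comm]
        gcongr _ * (_ * ?_)
        exact ENNReal.rpow_anti_of_nonpos (by linarith : q - 1 ≤ 0) (not_lt.1 h)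

lemma ENNReal.card_filter_lt_mul_le {ι : Type*} (s : Finset ι) (F : ι → ℝ≥0∞) {C : ℝ≥0∞}
    (hC0 : C ≠ 0) (hC1 : C ≠ ⊤) (N r : ℕ) (h : ∑ z ∈ s, F z ≤ N * C) :
    r * (s.filter fun z => r * C < F z).card ≤ N := by
  have h1 : (((r * (s.filter fun z => r * C < F z).card : ℕ) : ℝ≥0∞)) * C ≤ N * C := by
    calc _ = ∑ z ∈ s.filter fun z => r * C < F z, r * C := by
          simp only [Finset.sum_const, nsmul_eq_mul]
          push_cast
          ring
      _ ≤ ∑ z ∈ s.filter fun z => r * C < F z, F z :=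
          Finset.sum_le_sum fun z hz => (Finset.mem_filter.1 hz).2.le
      _ ≤ ∑ z ∈ s, F z := Finset.sum_le_sum_of_subset (Finset.filter_subset _ _)
      _ ≤ _ := h
  have := (ENNReal.mul_le_mul_iff_left hC0 hC1).1 h1
  exact_mod_cast this

lemma lintegral_list_sum_rpow_le {Ω β : Type*} [MeasurableSpace Ω] (μ : Measure Ω)
    {q : ℝ} (hq0 : 0 < q) (hq1 : q ≤ 1) {C : ℝ≥0∞} {ψ : β → Ω → ℝ≥0∞}
    (hψ : ∀ j, Measurable (ψ j)) (hC : ∀ j, ∫⁻ t, ψ j t ^ q ∂μ ≤ C) (J : List β) :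
    ∫⁻ t, (J.map (ψ · t)).sum ^ q ∂μ ≤ J.length * C := by
  induction J with
  | nil => simp [hq0]
  | cons j J ih =>
    simp only [List.map_cons, List.sum_cons, List.length_cons, Nat.cast_add, Nat.cast_one,
      add_mul, one_mul]
    calc _ ≤ ∫⁻ t, ψ j t ^ q + (J.map (ψ · t)).sum ^ q ∂μ :=
          lintegral_mono fun t => ENNReal.rpow_add_le_add_rpow _ _ hq0.le hq1
      _ = ∫⁻ t, ψ j t ^ q ∂μ + ∫⁻ t, (J.map (ψ · t)).sum ^ q ∂μ :=
          lintegral_add_left ((hψ j).pow_const q) _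
      _ ≤ C + J.length * C := by gcongr; exact hC j
      _ = _ := add_comm _ _

lemma lintegral_dominantSum_ge {Ω α β : Type*} [MeasurableSpace Ω] (μ : Measure Ω)
    {q : ℝ} {M c : ℝ≥0∞} {w : α → β → Ω → ℝ≥0∞} {ψ : β → Ω → ℝ≥0∞}
    (hw : ∀ i j, Measurable (w i j)) (hψ : ∀ j, Measurable (ψ j)) (i : α) (J : List β)
    (hJ : IsGoodList (fun J i j => c ≤ ∫⁻ t, (if M * (J.map (ψ · t)).sum < w i j t
      then w i j t ^ q else 0) ∂μ) i J) :
    J.length * c ≤ ∫⁻ t, dominantSum q M (w i · t) (ψ · t) J ∂μ := by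
  induction J with
  | nil => simp
  | cons j J ih =>
    simp only [dominantSum, List.length_cons, Nat.cast_add, Nat.cast_one, add_mul, one_mul]
    rw [lintegral_add_right _ (measurable_dominantSum q M (hw i) hψ J).2, add_comm]
    exact add_le_add hJ.1 (ih hJ.2)

/-- Markov's inequality for the weighted second moments of the rows of a nonnegative matrix:
few entries have a large moment with respect to the weight given by the mean of their row. -/
lemma card_large_weighted_moment_le {Ω : Type*} [MeasurableSpace Ω] (μ : Measure Ω) {q : ℝ}
    (hq0 : 0 < q) {n : ℕ} (hn : n ≠ 0) {C : ℝ≥0∞} (hC0 : C ≠ 0) (hC1 : C ≠ ⊤)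
    {g : Fin n → Fin n → Ω → ℝ≥0∞} (hg : ∀ i j, Measurable (g i j))
    (hC : ∀ i, ∫⁻ t, ((n : ℝ≥0∞)⁻¹ * ∑ j, g i j t) ^ q ∂μ ≤ C) (r : ℕ) :
    r * (Finset.univ.filter fun z : Fin n × Fin n => r * C < ∫⁻ t, g z.1 z.2 t *
      ((n : ℝ≥0∞)⁻¹ * ∑ j, g z.1 j t) ^ (q - 1) ∂μ).card ≤ n ^ 2 := by
  refine ENNReal.card_filter_lt_mul_le _ _ hC0 hC1 _ _ ?_
  rw [Fintype.sum_prod_type]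
  have hn0 : (n : ℝ≥0∞) ≠ 0 := by exact_mod_cast hn
  have h1 : ∀ i, ∑ j, ∫⁻ t, g i j t * ((n : ℝ≥0∞)⁻¹ * ∑ j, g i j t) ^ (q - 1) ∂μ ≤ n * C := by
    intro i
    have hm : Measurable fun t => (n : ℝ≥0∞)⁻¹ * ∑ j, g i j t :=
      (Finset.measurable_sum _ fun j _ => hg i j).const_mul _
    have hgm : ∀ j, Measurable fun t =>
        g i j t * ((n : ℝ≥0∞)⁻¹ * ∑ j, g i j t) ^ (q - 1) := fun j =>
      (hg i j).mul (hm.pow_const _)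
    rw [← lintegral_finsetSum _ fun j _ => hgm j]
    calc _ ≤ ∫⁻ t, n * ((n : ℝ≥0∞)⁻¹ * ∑ j, g i j t) ^ q ∂μ := by
          refine lintegral_mono fun t => ?_
          simp only []
          rw [← Finset.sum_mul]
          have h2 : ∑ j, g i j t = n * ((n : ℝ≥0∞)⁻¹ * ∑ j, g i j t) := by
            rw [← mul_assoc, ENNReal.mul_inv_cancel hn0 (by simp), one_mul]
          nth_rw 1 [h2]
          rw [mul_assoc]
          gcongr
          exact ENNReal.mul_rpow_sub_one_le hq0 _
      _ = n * ∫⁻ t, ((n : ℝ≥0∞)⁻¹ * ∑ j, g i j t) ^ q ∂μ :=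
          lintegral_const_mul _ (hm.pow_const q)
      _ ≤ n * C := by gcongr; exact hC i
  calc _ ≤ ∑ i : Fin n, n * C := Finset.sum_le_sum fun i _ => h1 i
    _ = _ := by simp; ring

/-- A large matrix of nonnegative functions cannot have uniformly bounded row and column
averages in `L^q` for some `0 < q < 1` while the `L^q` sizes of sums along increasing
diagonals grow linearly. -/
theorem exists_forall_matrix_false {Ω : Type*} [MeasurableSpace Ω] (μ : Measure Ω) {q : ℝ}
    (hq0 : 0 < q) (hq1 : q < 1) {C a : ℝ≥0∞} (hC0 : C ≠ 0) (hC1 : C ≠ ⊤) (ha0 : a ≠ 0)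
    (ha1 : a ≠ ⊤) :
    ∃ n : ℕ, n ≠ 0 ∧ ∀ g : Fin n → Fin n → Ω → ℝ≥0∞, (∀ i j, Measurable (g i j)) →
      (∀ i j t, g i j t ≠ ⊤) →
      (∀ i, ∫⁻ t, ((n : ℝ≥0∞)⁻¹ * ∑ j, g i j t) ^ q ∂μ ≤ C) →
      (∀ j, ∫⁻ t, ((n : ℝ≥0∞)⁻¹ * ∑ i, g i j t) ^ q ∂μ ≤ C) →
      ¬ ∀ (m : ℕ) (i j : Fin m → Fin n), StrictMono i → StrictMono j →
        m * a ≤ ∫⁻ t, (∑ k, g (i k) (j k) t) ^ q ∂μ := by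
  have ha4 : a / 4 ≠ 0 := by simp [ha0]
  have ha4' : a / 4 ≠ ⊤ := by simp [ENNReal.div_eq_top, ha1]
  have ha2 : a / 2 = a / 4 + a / 4 := by
    rw [← ENNReal.add_div, ← two_mul, mul_comm, show (4 : ℝ≥0∞) = 2 * 2 by norm_num,
      ENNReal.mul_div_mul_right _ _ (by norm_num) (by norm_num)]
  obtain ⟨R, hR0, hR1, hR⟩ := ENNReal.exists_rpow_neg_mul_le (s := 1 - q) (by linarith)
    (A := 2 * ((8 : ℕ) * C)) (e := a / 4) (by finiteness) ha4
  rw [neg_sub] at hR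
  have hRq0 : R ^ q ≠ 0 := (ENNReal.rpow_pos (pos_iff_ne_zero.2 hR0) hR1).ne'
  have hRq1 : R ^ q ≠ ⊤ := ENNReal.rpow_ne_top_of_nonneg hq0.le hR1
  obtain ⟨c, hc⟩ : ∃ c, c = a / 4 / R ^ q := ⟨_, rfl⟩
  have hc0 : c ≠ 0 := by simp [hc, ha0, hRq1]
  have hc1 : c ≠ ⊤ := by simp [hc, ENNReal.div_eq_top, ha1, hRq0]
  have hc2 : c / 2 ≠ 0 := by simp [hc0]
  obtain ⟨M, hM0, hM1, hM⟩ := ENNReal.exists_rpow_neg_mul_le hq0 hC1 hc2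
  obtain ⟨K, hK⟩ := ENNReal.exists_nat_gt (r := C / (c / 2))
    (by simp [ENNReal.div_eq_top, hC1, hc0])
  rw [ENNReal.div_lt_iff (.inl hc2) (.inr hC1)] at hK
  obtain ⟨N, hN⟩ := ENNReal.exists_nat_gt (r := (R * M) ^ q * (K * C) / (a / 4))
    (by
      have : (R * M) ^ q ≠ ⊤ := ENNReal.rpow_ne_top_of_nonneg hq0.le (by finiteness)
      exact ENNReal.div_ne_top (by finiteness) ha4)
  rw [ENNReal.div_lt_iff (.inl ha4) (.inl ha4')] at hN
  refine ⟨2 * N * 4 ^ (K + 2) + 1, by omega, ?_⟩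
  generalize hn : 2 * N * 4 ^ (K + 2) + 1 = n
  intro g hg hgt hrow hcol hdiag
  have hn0 : n ≠ 0 := by omega
  set φ : Fin n → Ω → ℝ≥0∞ := fun i t => (n : ℝ≥0∞)⁻¹ * ∑ j, g i j t with hφ
  set ψ : Fin n → Ω → ℝ≥0∞ := fun j t => (n : ℝ≥0∞)⁻¹ * ∑ i, g i j t with hψ
  set w : Fin n → Fin n → Ω → ℝ≥0∞ := fun i j t => min (φ i t) (ψ j t) with hw
  have hφm : ∀ i, Measurable (φ i) := fun i =>
    (Finset.measurable_sum _ fun j _ => hg i j).const_mul _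
  have hψm : ∀ j, Measurable (ψ j) := fun j =>
    (Finset.measurable_sum _ fun i _ => hg i j).const_mul _
  have hwm : ∀ i j, Measurable (w i j) := fun i j => (hφm i).min (hψm j)
  set E₁ := Finset.univ.filter fun z : Fin n × Fin n =>
    (8 : ℕ) * C < ∫⁻ t, g z.1 z.2 t * φ z.1 t ^ (q - 1) ∂μ with hE₁
  set E₂ := Finset.univ.filter fun z : Fin n × Fin n =>
    (8 : ℕ) * C < ∫⁻ t, g z.2 z.1 t * ψ z.1 t ^ (q - 1) ∂μ with hE₂
  have hE₁c : 8 * E₁.card ≤ n ^ 2 :=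
    card_large_weighted_moment_le μ hq0 hn0 hC0 hC1 hg hrow 8
  have hE₂c : 8 * E₂.card ≤ n ^ 2 :=
    card_large_weighted_moment_le μ hq0 hn0 hC0 hC1 (g := fun j i => g i j)
      (fun j i => hg i j) hcol 8
  set G := Finset.univ.filter fun z : Fin n × Fin n => z ∉ E₁ ∧ z.swap ∉ E₂ with hG
  have hGc : 3 * n ^ 2 ≤ 4 * G.card := by
    have h1 : (Finset.univ : Finset (Fin n × Fin n)).card ≤
        (G ∪ E₁ ∪ E₂.image Prod.swap).card := by
      refine Finset.card_le_card fun z _ => ?_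
      simp only [hG, Finset.mem_union, Finset.mem_filter, Finset.mem_univ, true_and,
        Finset.mem_image]
      by_cases h1 : z ∈ E₁
      · tauto
      by_cases h2 : z.swap ∈ E₂
      · exact .inr ⟨_, h2, Prod.swap_swap z⟩
      · tauto
    have h2 := h1.trans (Finset.card_union_le _ _)
    have h3 := Finset.card_union_le G E₁
    have h4 := Finset.card_image_le (s := E₂) (f := Prod.swap)
    simp only [Finset.card_univ, Fintype.card_prod, Fintype.card_fin, ← sq] at h2
    omega
  have hGw : ∀ z ∈ G, R ^ (q - 1) * ∫⁻ t, g z.1 z.2 t * w z.1 z.2 t ^ (q - 1) ∂μ ≤ a / 4 := by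
    intro z hz
    obtain ⟨h1, h2⟩ := (Finset.mem_filter.1 hz).2
    simp only [hE₁, hE₂, Finset.mem_filter, Finset.mem_univ, true_and, not_lt,
      Prod.fst_swap, Prod.snd_swap] at h1 h2
    refine le_trans ?_ hR
    have hm : Measurable fun t => g z.1 z.2 t * φ z.1 t ^ (q - 1) :=
      (hg _ _).mul ((hφm _).pow_const _)
    gcongr
    calc _ ≤ ∫⁻ t, g z.1 z.2 t * φ z.1 t ^ (q - 1) + g z.1 z.2 t * ψ z.2 t ^ (q - 1) ∂μ := by
          refine lintegral_mono fun t => ?_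
          simp only [hw, ← mul_add]
          gcongr
          rcases le_total (φ z.1 t) (ψ z.2 t) with h | h
          · simp [min_eq_left h]
          · simp [min_eq_right h]
      _ = _ := lintegral_add_left hm _
      _ ≤ _ := by rw [two_mul]; gcongr
  have hite : ∀ (J : List (Fin n)) (i j) (f : Ω → ℝ≥0∞), Measurable f → Measurable fun t =>
      if M * (J.map (ψ · t)).sum < w i j t then f t ^ q else 0 := fun J i j f hf =>
    Measurable.ite (measurableSet_lt ((measurable_dominantSum q M (hwm i) hψm J).1.const_mul M)
      (hwm i j)) (hf.pow_const q) measurable_const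
  have hgw : ∀ i j, Measurable fun t => g i j t * w i j t ^ (q - 1) := fun i j =>
    (hg i j).mul ((hwm i j).pow_const _)
  obtain ⟨i, J, hJ, hgood⟩ := exists_isGoodList (K := K) (B := 2 * N) (Nat.pos_of_ne_zero hn0)
    (by omega)
    (fun J i j => c ≤ ∫⁻ t, (if M * (J.map (ψ · t)).sum < w i j t then w i j t ^ q else 0) ∂μ)
    G hGc (by
      intro J hJ
      refine ⟨G.filter fun z => ∫⁻ t, (if M * (J.map (ψ · t)).sum < w z.1 z.2 t
        then g z.1 z.2 t ^ q else 0) ∂μ ≤ a / 2, ?_, ?_⟩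
      · refine (card_le_of_diagonals (N := N) _ fun m i j hi hj hmem => ?_).trans_eq (by ring)
        have h1 := hdiag m i j hi hj
        have h2 : ∫⁻ t, (∑ k, g (i k) (j k) t) ^ q ∂μ ≤
            m * (a / 2) + m * (a / 4) + (R * M) ^ q * (K * C) := by
          calc _ ≤ ∫⁻ t, (∑ k, (if M * (J.map (ψ · t)).sum < w (i k) (j k) t
                  then g (i k) (j k) t ^ q else 0) +
                R ^ (q - 1) * ∑ k, g (i k) (j k) t * w (i k) (j k) t ^ (q - 1)) +
                (R * M) ^ q * (J.map (ψ · t)).sum ^ q ∂μ := by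
                refine lintegral_mono fun t => ?_
                rw [← ENNReal.mul_rpow_of_nonneg _ _ hq0.le, mul_assoc]
                exact sum_rpow_le_dominant_add hq0 hq1 hR0 hR1 _ _ _ _ fun k => hgt _ _ _
            _ = ∑ k, ∫⁻ t, (if M * (J.map (ψ · t)).sum < w (i k) (j k) t
                  then g (i k) (j k) t ^ q else 0) ∂μ +
                ∑ k, R ^ (q - 1) * ∫⁻ t, g (i k) (j k) t * w (i k) (j k) t ^ (q - 1) ∂μ +
                (R * M) ^ q * ∫⁻ t, (J.map (ψ · t)).sum ^ q ∂μ := by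
                have hm1 : Measurable fun t => ∑ k, (if M * (J.map (ψ · t)).sum <
                    w (i k) (j k) t then g (i k) (j k) t ^ q else 0) :=
                  Finset.measurable_sum _ fun k _ => hite _ _ _ _ (hg _ _)
                have hm2 : Measurable fun t =>
                    ∑ k, g (i k) (j k) t * w (i k) (j k) t ^ (q - 1) :=
                  Finset.measurable_sum _ fun k _ => hgw _ _
                have hm3 : Measurable fun t =>
                    ∑ k, (if M * (J.map (ψ · t)).sum < w (i k) (j k) t
                      then g (i k) (j k) t ^ q else 0) +
                    R ^ (q - 1) * ∑ k, g (i k) (j k) t * w (i k) (j k) t ^ (q - 1) :=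
                  hm1.add (hm2.const_mul _)
                rw [lintegral_add_left hm3, lintegral_add_left hm1,
                  lintegral_const_mul _ hm2,
                  lintegral_const_mul _ ((measurable_dominantSum q M hψm hψm J).1.pow_const q),
                  lintegral_finsetSum _ fun k _ => hite _ _ _ _ (hg _ _),
                  lintegral_finsetSum _ fun k _ => hgw _ _, Finset.mul_sum]
            _ ≤ ∑ k : Fin m, a / 2 + ∑ k : Fin m, a / 4 + (R * M) ^ q * (K * C) := by
                gcongr with k _ k _
                · exact (Finset.mem_filter.1 (hmem k)).2
                · exact hGw _ (Finset.mem_filter.1 (hmem k)).1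
                · refine (lintegral_list_sum_rpow_le μ hq0 hq1.le hψm hcol J).trans ?_
                  gcongr
            _ = _ := by simp
        have h3 : m * (a / 4) ≤ N * (a / 4) := by
          have h4 : (m : ℝ≥0∞) * a = (m * (a / 2) + m * (a / 4)) + m * (a / 4) := by
            rw [add_assoc, ← mul_add, ← mul_add, ← ha2, ENNReal.add_halves]
          have h5 := h1.trans h2
          rw [h4] at h5
          exact ((ENNReal.add_le_add_iff_left (by finiteness)).1 h5).trans hN.le
        exact_mod_cast (ENNReal.mul_le_mul_iff_left ha4 ha4').1 h3
      · intro z hz hzS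
        have h1 : a / 2 < ∫⁻ t, (if M * (J.map (ψ · t)).sum < w z.1 z.2 t
            then g z.1 z.2 t ^ q else 0) ∂μ := by
          by_contra! h
          exact hzS (Finset.mem_filter.2 ⟨hz, h⟩)
        have h2 : ∫⁻ t, (if M * (J.map (ψ · t)).sum < w z.1 z.2 t
            then g z.1 z.2 t ^ q else 0) ∂μ ≤ a / 4 + R ^ q *
            ∫⁻ t, (if M * (J.map (ψ · t)).sum < w z.1 z.2 t then w z.1 z.2 t ^ q else 0) ∂μ := by
          calc _ ≤ ∫⁻ t, R ^ (q - 1) * (g z.1 z.2 t * w z.1 z.2 t ^ (q - 1)) +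
                R ^ q * (if M * (J.map (ψ · t)).sum < w z.1 z.2 t
                  then w z.1 z.2 t ^ q else 0) ∂μ := by
                refine lintegral_mono fun t => ?_
                simp only []
                split_ifs
                · refine (ENNReal.rpow_le_mul_rpow_sub_one_add hq0 hq1 (hgt _ _ t)
                    (R * w z.1 z.2 t)).trans_eq ?_
                  rw [ENNReal.mul_rpow_of_ne hR0 hR1, ENNReal.mul_rpow_of_ne hR0 hR1,
                    mul_left_comm]
                · exact zero_le
            _ = _ := by
                rw [lintegral_add_left ((hgw _ _).const_mul _),
                  lintegral_const_mul _ (hgw _ _),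
                  lintegral_const_mul _ (hite _ _ _ _ (hwm _ _))]
            _ ≤ _ := by gcongr; exact hGw z hz
        have h3 := h1.le.trans h2
        rw [ha2, ENNReal.add_le_add_iff_left ha4'] at h3
        rw [hc]
        exact ENNReal.div_le_of_le_mul' h3)
  have h1 := lintegral_dominantSum_ge μ hwm hψm i J hgood
  rw [hJ] at h1
  have h2 : ∫⁻ t, dominantSum q M (w i · t) (ψ · t) J ∂μ ≤ C + K * (c / 2) := by
    calc _ ≤ ∫⁻ t, φ i t ^ q + K * M ^ (-q) * φ i t ^ q ∂μ := by
          refine lintegral_mono fun t => ?_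
          rw [← hJ, mul_assoc]
          exact dominantSum_le hq0 hM0 hM1 (fun j => min_le_right _ _)
            (fun j => min_le_left _ _) J
      _ = ∫⁻ t, φ i t ^ q ∂μ + K * M ^ (-q) * ∫⁻ t, φ i t ^ q ∂μ := by
          rw [lintegral_add_left ((hφm i).pow_const q),
            lintegral_const_mul _ ((hφm i).pow_const q)]
      _ ≤ C + K * M ^ (-q) * C := by gcongr <;> exact hrow i
      _ ≤ _ := by rw [mul_assoc]; gcongr
  have h3 := h1.trans h2
  rw [← ENNReal.add_halves c, mul_add, ENNReal.add_halves c] at h3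
  have h4 := (ENNReal.add_le_add_iff_right (by finiteness)).1 h3
  exact absurd h4 (not_le.2 hK)

lemma ofReal_norm_rpow_eq_lintegral {Ω : Type*} [MeasurableSpace Ω] {μ : Measure Ω} {p : ℝ}
    (hp : 0 < p) [Fact (1 ≤ ENNReal.ofReal p)] (h : Lp ℝ (ENNReal.ofReal p) μ) :
    ENNReal.ofReal (‖h‖ ^ p) = ∫⁻ t, ENNReal.ofReal (|h t| ^ p) ∂μ := by
  have h1 : (ENNReal.ofReal p).toReal = p := ENNReal.toReal_ofReal hp.le
  rw [← ENNReal.ofReal_rpow_of_nonneg (norm_nonneg h) hp.le, Lp.norm_def,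
    ENNReal.ofReal_toReal (Lp.eLpNorm_ne_top h),
    eLpNorm_eq_lintegral_rpow_enorm_toReal (by simpa using hp) (by simp), h1,
    ← ENNReal.rpow_mul, one_div, inv_mul_cancel₀ hp.ne', ENNReal.rpow_one]
  refine lintegral_congr fun t => ?_
  rw [← ENNReal.ofReal_rpow_of_nonneg (abs_nonneg _) hp.le, Real.enorm_eq_ofReal_abs]

lemma sum_ofReal_norm_sign_sum {Ω : Type*} [MeasurableSpace Ω] {μ : Measure Ω} {p : ℝ}
    (hp : 0 < p) {m : ℕ} [Fact (1 ≤ ENNReal.ofReal p)] (x : Fin m → Lp ℝ (ENNReal.ofReal p) μ) :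
    ∑ e : Fin m → Bool, ENNReal.ofReal (‖∑ k, boolSign (e k) • x k‖ ^ p) =
      ∫⁻ t, ENNReal.ofReal (∑ e : Fin m → Bool, |∑ k, boolSign (e k) * x k t| ^ p) ∂μ := by
  have hm : ∀ e : Fin m → Bool,
      Measurable fun t => ENNReal.ofReal (|∑ k, boolSign (e k) * x k t| ^ p) := fun e =>
    ((Finset.measurable_sum _ fun k _ =>
      (Lp.stronglyMeasurable (x k)).measurable.const_mul _).abs.pow_const p).ennreal_ofReal
  have h1 : ∀ t, ENNReal.ofReal (∑ e : Fin m → Bool, |∑ k, boolSign (e k) * x k t| ^ p) =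
      ∑ e : Fin m → Bool, ENNReal.ofReal (|∑ k, boolSign (e k) * x k t| ^ p) := fun t =>
    ENNReal.ofReal_sum_of_nonneg fun e _ => by positivity
  simp_rw [h1]
  rw [lintegral_finsetSum _ fun e _ => hm e]
  refine Finset.sum_congr rfl fun e _ => ?_
  rw [ofReal_norm_rpow_eq_lintegral hp]
  refine lintegral_congr_ae ?_
  have h2 : ∀ᵐ t ∂μ, ∀ k, (boolSign (e k) • x k : Lp ℝ (ENNReal.ofReal p) μ) t =
      boolSign (e k) * x k t := ae_all_iff.2 fun k => by
    filter_upwards [Lp.coeFn_smul (boolSign (e k)) (x k)] with t ht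
    simpa using ht
  filter_upwards [Lp.coeFn_fun_finsetSum Finset.univ fun k => boolSign (e k) • x k, h2]
    with t ht h2t
  rw [ht]
  simp only [h2t]

lemma lintegral_sum_sq_rpow_le {Ω : Type*} [MeasurableSpace Ω] {μ : Measure Ω} {p : ℝ}
    (hp : 0 < p) (hp2 : p ≤ 2) {m : ℕ} [Fact (1 ≤ ENNReal.ofReal p)]
    (x : Fin m → Lp ℝ (ENNReal.ofReal p) μ) {B : ℝ}
    (hB : ∀ e : Fin m → Bool, ‖∑ k, boolSign (e k) • x k‖ ≤ B) :
    ∫⁻ t, (∑ k, ENNReal.ofReal (x k t ^ 2)) ^ (p / 2) ∂μ ≤ ENNReal.ofReal (16 * B ^ p) := by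
  have hB0 : 0 ≤ B := (norm_nonneg _).trans (hB fun _ => true)
  have h2 : ENNReal.ofReal (2 ^ m) ≠ 0 := by simp
  refine (ENNReal.mul_le_mul_iff_right h2 ENNReal.ofReal_ne_top).1 ?_
  rw [← lintegral_const_mul' _ _ ENNReal.ofReal_ne_top]
  calc _ ≤ ∫⁻ t, ENNReal.ofReal 16 * ENNReal.ofReal
        (∑ e : Fin m → Bool, |∑ k, boolSign (e k) * x k t| ^ p) ∂μ := by
        refine lintegral_mono fun t => ?_
        simp only []
        rw [← ENNReal.ofReal_sum_of_nonneg fun k _ => sq_nonneg _,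
          ENNReal.ofReal_rpow_of_nonneg (Finset.sum_nonneg fun k _ => sq_nonneg _)
            (half_pos hp).le, ← ENNReal.ofReal_mul (by positivity),
          ← ENNReal.ofReal_mul (by positivity)]
        exact ENNReal.ofReal_le_ofReal (le_sum_sign_rpow (fun k => x k t) hp hp2)
    _ = ENNReal.ofReal 16 * ∑ e : Fin m → Bool,
          ENNReal.ofReal (‖∑ k, boolSign (e k) • x k‖ ^ p) := by
        rw [lintegral_const_mul' _ _ ENNReal.ofReal_ne_top, sum_ofReal_norm_sign_sum hp]
    _ ≤ ENNReal.ofReal 16 * ∑ e : Fin m → Bool, ENNReal.ofReal (B ^ p) := by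
        gcongr with e _
        exact hB e
    _ = _ := by
        rw [← ENNReal.ofReal_sum_of_nonneg fun _ _ => by positivity,
          ← ENNReal.ofReal_mul (by positivity), ← ENNReal.ofReal_mul (by positivity)]
        congr 1
        simp
        ring

lemma le_lintegral_sum_sq_rpow {Ω : Type*} [MeasurableSpace Ω] {μ : Measure Ω} {p : ℝ}
    (hp : 0 < p) (hp2 : p ≤ 2) {m : ℕ} [Fact (1 ≤ ENNReal.ofReal p)]
    (x : Fin m → Lp ℝ (ENNReal.ofReal p) μ) {B : ℝ} (hB0 : 0 ≤ B)
    (hB : ∀ e : Fin m → Bool, B ≤ ‖∑ k, boolSign (e k) • x k‖) :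
    ENNReal.ofReal (B ^ p / 2) ≤ ∫⁻ t, (∑ k, ENNReal.ofReal (x k t ^ 2)) ^ (p / 2) ∂μ := by
  have h2 : ENNReal.ofReal (2 ^ m * 2) ≠ 0 := by simp
  refine (ENNReal.mul_le_mul_iff_right h2 ENNReal.ofReal_ne_top).1 ?_
  rw [← lintegral_const_mul' _ _ ENNReal.ofReal_ne_top]
  calc _ = ∑ e : Fin m → Bool, ENNReal.ofReal (B ^ p) := by
        rw [← ENNReal.ofReal_sum_of_nonneg fun _ _ => by positivity,
          ← ENNReal.ofReal_mul (by positivity)]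
        congr 1
        simp
        ring
    _ ≤ ∑ e : Fin m → Bool, ENNReal.ofReal (‖∑ k, boolSign (e k) • x k‖ ^ p) := by
        gcongr with e _
        exact hB e
    _ = _ := sum_ofReal_norm_sign_sum hp x
    _ ≤ _ := by
        refine lintegral_mono fun t => ?_
        simp only []
        rw [← ENNReal.ofReal_sum_of_nonneg fun k _ => sq_nonneg _,
          ENNReal.ofReal_rpow_of_nonneg (Finset.sum_nonneg fun k _ => sq_nonneg _)
            (half_pos hp).le, ← ENNReal.ofReal_mul (by positivity)]
        refine ENNReal.ofReal_le_ofReal ?_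
        rw [mul_assoc]
        exact sum_sign_rpow_le (fun k => x k t) hp hp2

lemma lintegral_mean_sq_rpow_le_of_isLqBasisEquivFin {Ω : Type*} [MeasurableSpace Ω]
    {μ : Measure Ω} {p K : ℝ} (hp : 0 < p) (hp2 : p ≤ 2) (hK : 0 ≤ K) {n : ℕ} (hn : n ≠ 0)
    [Fact (1 ≤ ENNReal.ofReal p)] {x : Fin n → Lp ℝ (ENNReal.ofReal p) μ}
    (hx : IsLqBasisEquivFin 2 K x) :
    ∫⁻ t, ((n : ℝ≥0∞)⁻¹ * ∑ k, ENNReal.ofReal (x k t ^ 2)) ^ (p / 2) ∂μ ≤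
      ENNReal.ofReal (16 * K ^ p) := by
  have h1 := lintegral_sum_sq_rpow_le hp hp2 x (B := K * (n : ℝ) ^ (1 / 2 : ℝ)) fun e => by
    simpa [abs_boolSign] using (hx fun k => boolSign (e k)).2
  have hn0 : (n : ℝ≥0∞) ≠ 0 := by exact_mod_cast hn
  have hnq : (n : ℝ≥0∞) ^ (p / 2) ≠ 0 := by simp [hn]
  have hnq' : (n : ℝ≥0∞) ^ (p / 2) ≠ ⊤ := ENNReal.rpow_ne_top_of_nonneg (by positivity) (by simp)
  simp_rw [ENNReal.mul_rpow_of_nonneg _ _ (half_pos hp).le, ENNReal.inv_rpow]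
  rw [lintegral_const_mul' _ _ (by simpa using hnq), mul_comm, ← div_eq_mul_inv]
  refine ENNReal.div_le_of_le_mul (h1.trans_eq ?_)
  rw [← ENNReal.ofReal_natCast, ENNReal.ofReal_rpow_of_nonneg (by positivity) (by positivity),
    ← ENNReal.ofReal_mul (by positivity), Real.mul_rpow hK (by positivity),
    ← Real.rpow_mul (by positivity), mul_assoc]
  congr 4
  ring

lemma le_lintegral_sum_sq_rpow_of_isLqBasisEquivFin {Ω : Type*} [MeasurableSpace Ω]
    {μ : Measure Ω} {p K : ℝ} (hp : 0 < p) (hp2 : p ≤ 2) (hK : 0 ≤ K) {m : ℕ}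
    [Fact (1 ≤ ENNReal.ofReal p)] {x : Fin m → Lp ℝ (ENNReal.ofReal p) μ}
    (hx : IsLqBasisEquivFin p K x) :
    m * ENNReal.ofReal ((1 / K) ^ p / 2) ≤
      ∫⁻ t, (∑ k, ENNReal.ofReal (x k t ^ 2)) ^ (p / 2) ∂μ := by
  have h1 := le_lintegral_sum_sq_rpow hp hp2 x (B := 1 / K * (m : ℝ) ^ (1 / p))
    (by positivity) fun e => by
      simpa [abs_boolSign] using (hx fun k => boolSign (e k)).1
  refine le_trans (le_of_eq ?_) h1
  rw [Real.mul_rpow (by positivity) (by positivity), ← Real.rpow_mul (by positivity), one_div p,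
    inv_mul_cancel₀ hp.ne', Real.rpow_one, ← ENNReal.ofReal_natCast,
    ← ENNReal.ofReal_mul (by positivity)]
  congr 1
  ring

/-- (Equivalent form of Corollary 1.4.) -/
theorem statement2 (p : ℝ) (hp1 : 1 ≤ p) (hp2 : p < 2)
    [Fact (1 ≤ ENNReal.ofReal p)]
    (lam : ℝ) (hlam : 1 ≤ lam) :
    ∃ n : ℕ,
      ¬ ∃ x : Fin n → Fin n →
          Lp ℝ (ENNReal.ofReal p) (volume.restrict (Set.Icc (0:ℝ) 1)),
        (∀ i, IsLqBasisEquivFin 2 lam fun j => x i j) ∧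
        (∀ j, IsLqBasisEquivFin 2 lam fun i => x i j) ∧
        (∀ (m : ℕ) (i j : Fin m → Fin n), StrictMono i → StrictMono j →
          IsLqBasisEquivFin p lam fun k => x (i k) (j k)) := by
  have hp : 0 < p := by linarith
  have hl : 0 < lam := by linarith
  have hlp : 0 < lam ^ p := by positivity
  obtain ⟨n, hn, hmain⟩ := exists_forall_matrix_false
    (volume.restrict (Set.Icc (0 : ℝ) 1)) (q := p / 2) (by linarith) (by linarith)
    (C := ENNReal.ofReal (16 * lam ^ p)) (a := ENNReal.ofReal ((1 / lam) ^ p / 2))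
    (ENNReal.ofReal_pos.2 (by positivity)).ne' ENNReal.ofReal_ne_top
    (ENNReal.ofReal_pos.2 (by positivity)).ne' ENNReal.ofReal_ne_top
  refine ⟨n, ?_⟩
  rintro ⟨x, hrow, hcol, hdiag⟩
  refine hmain (fun i j t => ENNReal.ofReal (x i j t ^ 2))
    (fun i j => ((Lp.stronglyMeasurable (x i j)).measurable.pow_const 2).ennreal_ofReal)
    (fun _ _ _ => ENNReal.ofReal_ne_top)
    (fun i => lintegral_mean_sq_rpow_le_of_isLqBasisEquivFin hp hp2.le hl.le hn (hrow i))
    (fun j => lintegral_mean_sq_rpow_le_of_isLqBasisEquivFin hp hp2.le hl.le hn (hcol j))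
    fun m i j hi hj => le_lintegral_sum_sq_rpow_of_isLqBasisEquivFin hp hp2.le hl.le
      (hdiag m i j hi hj)

end
end
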